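/- arXiv:2010.02476 — 2 statements merged into one kernel-verified Lean document; each statement's English description precedes it below -/
import Mathlib

section
/- Let p ≥ 1 and κ > p/2 + 1, and let {B(t), 0 ≤ t ≤ 1} be a Brownian bridge. Let t_1 = t_1(N), t_2 = t_2(N) with 0 < t_1 < t_2 < 1 satisfy t_1(N) → 0 and t_2(N) → 1, and assume that, with r_N = min(t_1(N), 1−t_2(N)), the limits γ_1 = lim_N r_N / t_1(N) and γ_2 = lim_N r_N / (1−t_2(N)) exist. Then r_N^{κ−p/2−1} ∫_{t_1}^{t_2} |B(t)|^p / (t(1−t))^κ dt converges in distribution, as N → ∞, to 𝔟(p,κ) = γ_1^{κ−p/2−1} 𝔟_1(p,κ) + γ_2^{κ−p/2−1} 𝔟_2(p,κ), where 𝔟_1(p,κ) and 𝔟_2(p,κ) are independent random variables, each distributed as ∫_1^∞ |W(t)|^p / t^κ dt for a standard Wiener process {W(t), t ≥ 0}. -/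
open MeasureTheory ProbabilityTheory Filter Set Topology

noncomputable section

variable {Ω : Type*} [MeasurableSpace Ω]

/-- A real-indexed process is (mean-zero) Gaussian on the index set `T`: every finite
linear combination of its values has a centred Gaussian distribution. -/
def IsGaussianOn (P : Measure Ω) (W : Ω → ℝ → ℝ) (T : Set ℝ) : Prop :=
  ∀ (n : ℕ) (t : Fin n → ℝ), (∀ i, t i ∈ T) → ∀ c : Fin n → ℝ,
    ∃ v : NNReal, P.map (fun ω => ∑ i, c i * W ω (t i)) = gaussianReal 0 v

/-- A standard Wiener process on the index set `T ⊆ [0,∞)`. -/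
structure IsWienerProcessOn (P : Measure Ω) (W : Ω → ℝ → ℝ) (T : Set ℝ) : Prop where
  meas : ∀ t ∈ T, Measurable fun ω => W ω t
  gauss : IsGaussianOn P W T
  cont : ∀ᵐ ω ∂P, ContinuousOn (W ω) T
  zero : ∀ᵐ ω ∂P, W ω 0 = 0
  cov : ∀ s ∈ T, ∀ t ∈ T, ∫ ω, W ω s * W ω t ∂P = min s t

/-- A Brownian bridge on `[0,1]`. -/
structure IsBrownianBridge (P : Measure Ω) (B : Ω → ℝ → ℝ) : Prop where
  meas : ∀ t ∈ Icc (0:ℝ) 1, Measurable fun ω => B ω t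
  gauss : IsGaussianOn P B (Icc 0 1)
  cont : ∀ᵐ ω ∂P, ContinuousOn (B ω) (Icc 0 1)
  cov : ∀ s ∈ Icc (0:ℝ) 1, ∀ t ∈ Icc (0:ℝ) 1,
    ∫ ω, B ω s * B ω t ∂P = min s t - s * t

/-- `ξ_N = O_P(1)`: bounded in probability. -/
def IsBddInProb (P : Measure Ω) (ξ : ℕ → Ω → ℝ) : Prop :=
  ∀ ε : ℝ, 0 < ε → ∃ M : ℝ, ∀ N, P {ω | M < |ξ N ω|} ≤ ENNReal.ofReal ε

/-- `ξ_N = O_P(a_N)`. -/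
def IsOP (P : Measure Ω) (ξ : ℕ → Ω → ℝ) (a : ℕ → ℝ) : Prop :=
  IsBddInProb P (fun N ω => ξ N ω / a N)

/-- Assumption 1: strong approximation of the partial sums of the errors by two
independent Wiener processes, with rate exponent `ζ < 1/2` and scale `σ > 0`. -/
structure Assumption1 (P : Measure Ω) (eps : ℕ → Ω → ℝ)
    (σ ζ : ℝ) (W1 W2 : ℕ → Ω → ℝ → ℝ) : Prop where
  hσ : 0 < σ
  hζ : ζ < 1/2
  wiener1 : ∀ N : ℕ, IsWienerProcessOn P (W1 N) (Icc 0 ((N:ℝ)/2))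
  wiener2 : ∀ N : ℕ, IsWienerProcessOn P (W2 N) (Icc 0 ((N:ℝ)/2))
  indep : ∀ N : ℕ, IndepFun (W1 N) (W2 N) P
  approx1 : IsBddInProb P (fun N ω =>
    ⨆ k : {k : ℕ // 1 ≤ k ∧ (k:ℝ) ≤ (N:ℝ)/2},
      ((k:ℕ):ℝ) ^ (-ζ) *
        |(∑ i ∈ Finset.Icc 1 (k:ℕ), eps i ω) - σ * W1 N ω ((k:ℕ):ℝ)|)
  approx2 : IsBddInProb P (fun N ω =>
    ⨆ k : {k : ℕ // (N:ℝ)/2 < (k:ℝ) ∧ (k:ℕ) < N},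
      ((N:ℝ) - ((k:ℕ):ℝ)) ^ (-ζ) *
        |(∑ i ∈ Finset.Icc ((k:ℕ)+1) N, eps i ω) - σ * W2 N ω ((N:ℝ) - ((k:ℕ):ℝ))|)

/-- The normalized CUSUM process `Z_N(t) = N^{-1/2} (Σ_{i≤⌊(N+1)t⌋} X_i − (⌊(N+1)t⌋/N) Σ_{i≤N} X_i)`. -/
def cusum (X : ℕ → Ω → ℝ) (N : ℕ) (ω : Ω) (t : ℝ) : ℝ :=
  (Real.sqrt N)⁻¹ * ((∑ i ∈ Finset.Icc 1 ⌊((N:ℝ) + 1) * t⌋₊, X i ω)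
    - (⌊((N:ℝ) + 1) * t⌋₊ : ℝ) / (N:ℝ) * ∑ i ∈ Finset.Icc 1 N, X i ω)

/-- Convergence in distribution of real random variables to the law `μ`. -/
def TendstoInDist (P : Measure Ω) (ξ : ℕ → Ω → ℝ) (μ : Measure ℝ) : Prop :=
  ∀ f : BoundedContinuousFunction ℝ ℝ,
    Tendsto (fun N => ∫ ω, f (ξ N ω) ∂P) atTop (𝓝 (∫ x, f x ∂μ))

/-- The standard normal density. -/
def stdNormalDensity (x : ℝ) : ℝ := (Real.sqrt (2 * Real.pi))⁻¹ * Real.exp (-x^2 / 2)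

/-- `b(p) = ∫ |x|^p φ(x) dx`. -/
def bConst (p : ℝ) : ℝ := ∫ x : ℝ, |x| ^ p * stdNormalDensity x

/-- The constant `a(p)` from the paper. -/
def aConst (p : ℝ) : ℝ :=
  ∫ u : ℝ, ∫ y : ℝ, ∫ x : ℝ, |x * y| ^ p *
    ((2 * Real.pi * Real.sqrt (1 - Real.exp (-2 * |u|)))⁻¹ *
        Real.exp (-(x^2 + y^2 - 2 * Real.exp (-|u|) * |x * y|) /
          (2 * (1 - Real.exp (-2 * |u|))))
      - stdNormalDensity x * stdNormalDensity y)

/-- Second-order facts about a real random variable with a centred Gaussian law. -/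
lemma memLp_of_map_eq_gaussianReal {P : Measure Ω} {Z : Ω → ℝ} {v : NNReal}
    (h : P.map Z = gaussianReal 0 v) {q : ENNReal} (hq : q ≠ ⊤) : MemLp Z q P := by
  have hZ : AEMeasurable Z P := AEMeasurable.of_map_ne_zero (by
    rw [h]; exact NeZero.ne _)
  have := memLp_id_gaussianReal' (μ := 0) (v := v) q hq
  rw [← h] at this
  exact (memLp_map_measure_iff aestronglyMeasurable_id hZ).1 this

lemma integral_mul_self_of_map_eq_gaussianReal {P : Measure Ω} {Z : Ω → ℝ} {v : NNReal}
    (h : P.map Z = gaussianReal 0 v) : ∫ ω, Z ω * Z ω ∂P = v := by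
  have hZ : AEMeasurable Z P := AEMeasurable.of_map_ne_zero (by
    rw [h]; exact NeZero.ne _)
  have h1 : ∫ ω, Z ω * Z ω ∂P = ∫ x, x * x ∂(P.map Z) := by
    rw [integral_map hZ (by fun_prop)]
  have h2 := variance_fun_id_gaussianReal (μ := 0) (v := v)
  rw [variance_eq_integral measurable_id'.aemeasurable] at h2
  simp only [integral_id_gaussianReal, sub_zero] at h2
  rw [h1, h, ← h2]
  simp only [sq]

lemma IsGaussianOn.exists_map_sum {P : Measure Ω} {W : Ω → ℝ → ℝ} {T : Set ℝ}
    (h : IsGaussianOn P W T) {ι : Type*} [Fintype ι] (t : ι → ℝ) (ht : ∀ i, t i ∈ T)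
    (c : ι → ℝ) : ∃ v : NNReal, P.map (fun ω => ∑ i, c i * W ω (t i)) = gaussianReal 0 v := by
  obtain ⟨v, hv⟩ := h _ (t ∘ (Fintype.equivFin ι).symm) (fun i => ht _)
    (c ∘ (Fintype.equivFin ι).symm)
  refine ⟨v, ?_⟩
  rw [← hv]
  congr 1
  funext ω
  exact (Equiv.sum_comp (Fintype.equivFin ι).symm (fun i => c i * W ω (t i))).symm

lemma IsGaussianOn.exists_map {P : Measure Ω} {W : Ω → ℝ → ℝ} {T : Set ℝ}
    (h : IsGaussianOn P W T) {t : ℝ} (ht : t ∈ T) :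
    ∃ v : NNReal, P.map (fun ω => W ω t) = gaussianReal 0 v := by
  obtain ⟨v, hv⟩ := h.exists_map_sum (fun _ : Unit => t) (fun _ => ht) (fun _ => 1)
  exact ⟨v, by simpa using hv⟩

lemma IsGaussianOn.memLp_two {P : Measure Ω} {W : Ω → ℝ → ℝ} {T : Set ℝ}
    (h : IsGaussianOn P W T) {t : ℝ} (ht : t ∈ T) : MemLp (fun ω => W ω t) 2 P := by
  obtain ⟨v, hv⟩ := h.exists_map ht
  exact memLp_of_map_eq_gaussianReal hv (by norm_num)

/-- The covariance of two finite linear combinations of a Gaussian process. -/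
lemma IsGaussianOn.integral_sum_mul_sum {P : Measure Ω} {W : Ω → ℝ → ℝ} {T : Set ℝ}
    (h : IsGaussianOn P W T) {ι ι' : Type*} [Fintype ι] [Fintype ι']
    (s : ι → ℝ) (hs : ∀ i, s i ∈ T) (t : ι' → ℝ) (ht : ∀ i, t i ∈ T)
    (c : ι → ℝ) (d : ι' → ℝ) :
    ∫ ω, (∑ i, c i * W ω (s i)) * (∑ j, d j * W ω (t j)) ∂P
      = ∑ i, ∑ j, c i * d j * ∫ ω, W ω (s i) * W ω (t j) ∂P := by
  have hint : ∀ i j, Integrable (fun ω => c i * d j * (W ω (s i) * W ω (t j))) P :=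
    fun i j => ((h.memLp_two (hs i)).integrable_mul (h.memLp_two (ht j))).const_mul _
  simp_rw [Finset.sum_mul_sum]
  rw [integral_finsetSum _ fun i _ => ?_]
  · refine Finset.sum_congr rfl fun i _ => ?_
    rw [integral_finsetSum _ fun j _ => ?_]
    · refine Finset.sum_congr rfl fun j _ => ?_
      rw [← integral_const_mul]
      exact integral_congr_ae (ae_of_all _ fun ω => by ring)
    · exact (hint i j).congr (ae_of_all _ fun ω => by ring)
  · exact (integrable_finsetSum _ fun j _ => hint i j).congr (ae_of_all _ fun ω =>
      Finset.sum_congr rfl fun j _ => by ring)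

/-- A process whose values are finite linear combinations of a Gaussian process is Gaussian. -/
lemma IsGaussianOn.of_linear_combination {P : Measure Ω} {W X : Ω → ℝ → ℝ} {S T : Set ℝ}
    (h : IsGaussianOn P W T) {ι : Type*} [Fintype ι] (a τ : ℝ → ι → ℝ)
    (hτ : ∀ t ∈ S, ∀ j, τ t j ∈ T)
    (hX : ∀ t ∈ S, ∀ ω, X ω t = ∑ j, a t j * W ω (τ t j)) : IsGaussianOn P X S := by
  intro n t ht c
  obtain ⟨v, hv⟩ := h.exists_map_sum (ι := Fin n × ι) (fun x => τ (t x.1) x.2)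
    (fun x => hτ _ (ht x.1) x.2) (fun x => c x.1 * a (t x.1) x.2)
  refine ⟨v, ?_⟩
  rw [← hv]
  congr 1
  funext ω
  rw [Fintype.sum_prod_type]
  refine Finset.sum_congr rfl fun i _ => ?_
  rw [hX _ (ht i), Finset.mul_sum]
  exact Finset.sum_congr rfl fun j _ => by ring

/-- Centred Gaussian processes with the same covariance have the same finite-dimensional laws. -/
lemma IsGaussianOn.map_eq_map {Ω' : Type*} [MeasurableSpace Ω'] {P : Measure Ω} {P' : Measure Ω'}
    [IsProbabilityMeasure P] [IsProbabilityMeasure P']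
    {X : Ω → ℝ → ℝ} {Y : Ω' → ℝ → ℝ} {T : Set ℝ}
    (hX : IsGaussianOn P X T) (hY : IsGaussianOn P' Y T)
    (mX : ∀ t ∈ T, Measurable fun ω => X ω t) (mY : ∀ t ∈ T, Measurable fun ω => Y ω t)
    (hcov : ∀ s ∈ T, ∀ t ∈ T, ∫ ω, X ω s * X ω t ∂P = ∫ ω, Y ω s * Y ω t ∂P')
    {n : ℕ} (t : Fin n → ℝ) (ht : ∀ i, t i ∈ T) :
    P.map (fun ω i => X ω (t i)) = P'.map (fun ω i => Y ω (t i)) := by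
  have mX' : Measurable fun ω i => X ω (t i) := measurable_pi_lambda _ fun i => mX _ (ht i)
  have mY' : Measurable fun ω i => Y ω (t i) := measurable_pi_lambda _ fun i => mY _ (ht i)
  have : IsProbabilityMeasure (P.map (fun ω i => X ω (t i))) :=
    Measure.isProbabilityMeasure_map mX'.aemeasurable
  have : IsProbabilityMeasure (P'.map (fun ω i => Y ω (t i))) :=
    Measure.isProbabilityMeasure_map mY'.aemeasurable
  apply Measure.ext_of_charFunDual
  funext L
  have hL : ∀ x : Fin n → ℝ, L x = ∑ i, L (Pi.single i 1) * x i := by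
    intro x
    conv_lhs => rw [← Finset.univ_sum_single x]
    rw [map_sum]
    refine Finset.sum_congr rfl fun i _ => ?_
    rw [show (Pi.single i (x i) : Fin n → ℝ) = x i • Pi.single i 1 by
      rw [← Pi.single_smul]; simp, map_smul, smul_eq_mul, mul_comm]
  rw [charFunDual_eq_charFun_map_one, charFunDual_eq_charFun_map_one,
    Measure.map_map (by fun_prop) mX', Measure.map_map (by fun_prop) mY']
  congr 1
  have e1 : (L ∘ fun ω i => X ω (t i)) = fun ω => ∑ i, L (Pi.single i 1) * X ω (t i) := by
    funext ω; simp only [Function.comp]; rw [hL]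
  have e2 : (L ∘ fun ω i => Y ω (t i)) = fun ω => ∑ i, L (Pi.single i 1) * Y ω (t i) := by
    funext ω; simp only [Function.comp]; rw [hL]
  rw [e1, e2]
  obtain ⟨v, hv⟩ := hX n t ht (fun i => L (Pi.single i 1))
  obtain ⟨w, hw⟩ := hY n t ht (fun i => L (Pi.single i 1))
  have hvw : v = w := by
    have h1 := integral_mul_self_of_map_eq_gaussianReal hv
    have h2 := integral_mul_self_of_map_eq_gaussianReal hw
    rw [hX.integral_sum_mul_sum t ht t ht] at h1
    rw [hY.integral_sum_mul_sum t ht t ht] at h2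
    apply NNReal.coe_injective
    rw [← h1, ← h2]
    exact Finset.sum_congr rfl fun i _ => Finset.sum_congr rfl fun j _ => by
      rw [hcov _ (ht i) _ (ht j)]
  rw [hv, hw, hvw]

/-- Left Riemann sums of a continuous function on `[0, 1]` converge to its integral. -/
lemma tendsto_riemannSum_unitInterval {g : ℝ → ℝ} (hg : ContinuousOn g (Icc 0 1)) :
    Tendsto (fun n : ℕ => ∑ i : Fin (n + 1), ((n : ℝ) + 1)⁻¹ * g (i / ((n : ℝ) + 1))) atTop
      (𝓝 (∫ x in (0:ℝ)..1, g x)) := by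
  have huc : UniformContinuousOn g (Icc 0 1) :=
    isCompact_Icc.uniformContinuousOn_of_continuous hg
  rw [Metric.tendsto_atTop]
  intro ε hε
  rw [Metric.uniformContinuousOn_iff] at huc
  obtain ⟨δ, hδ, hgδ⟩ := huc (ε / 2) (by positivity)
  obtain ⟨n₀, hn₀⟩ := exists_nat_gt δ⁻¹
  refine ⟨n₀, fun n hn => ?_⟩
  have hm : (0:ℝ) < (n:ℝ) + 1 := by positivity
  have hmδ : ((n:ℝ) + 1)⁻¹ < δ := by
    rw [inv_lt_comm₀ hm hδ]
    have : (n₀:ℝ) ≤ n := by exact_mod_cast hn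
    linarith
  set m : ℝ := (n:ℝ) + 1 with hm_def
  have hsub : ∀ i < n + 1, Icc ((i:ℝ) / m) (((i + 1 : ℕ):ℝ) / m) ⊆ Icc 0 1 := by
    intro i hi x hx
    have hi' : (((i + 1 : ℕ):ℝ)) ≤ m := by rw [hm_def]; exact_mod_cast hi
    exact ⟨le_trans (by positivity) hx.1, hx.2.trans ((div_le_one hm).2 hi')⟩
  have hle : ∀ i : ℕ, (i:ℝ) / m ≤ ((i + 1 : ℕ):ℝ) / m := fun i => by
    gcongr; simp
  have hii : ∀ i < n + 1,
      IntervalIntegrable g volume ((i:ℝ) / m) (((i + 1 : ℕ):ℝ) / m) := by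
    intro i hi
    refine ContinuousOn.intervalIntegrable ?_
    rw [uIcc_of_le (hle i)]
    exact hg.mono (hsub i hi)
  have hsplit := intervalIntegral.sum_integral_adjacent_intervals
    (a := fun i : ℕ => (i:ℝ) / m) (n := n + 1) hii
  have h0 : ((0:ℕ):ℝ) / m = 0 := by simp
  have h1 : ((n + 1 : ℕ):ℝ) / m = 1 := by
    rw [hm_def]; push_cast; exact div_self hm.ne'
  rw [h0, h1] at hsplit
  rw [← hsplit, Finset.sum_fin_eq_sum_range, Real.dist_eq]
  have hcongr : (∑ i ∈ Finset.range (n + 1),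
      if h : i < n + 1 then m⁻¹ * g (((⟨i, h⟩ : Fin (n + 1)) : ℕ) / m) else 0)
      = ∑ i ∈ Finset.range (n + 1), m⁻¹ * g ((i:ℝ) / m) :=
    Finset.sum_congr rfl fun i hi => by rw [dif_pos (Finset.mem_range.1 hi)]
  rw [hcongr, ← Finset.sum_sub_distrib]
  have hlen : ∀ i : ℕ, ((i + 1 : ℕ):ℝ) / m - (i:ℝ) / m = m⁻¹ := fun i => by
    push_cast; field_simp; ring
  have hterm : ∀ i ∈ Finset.range (n + 1),
      |m⁻¹ * g ((i:ℝ) / m) - ∫ x in ((i:ℝ) / m)..(((i + 1 : ℕ):ℝ) / m), g x| ≤ ε / 2 * m⁻¹ := by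
    intro i hi
    have hi := Finset.mem_range.1 hi
    have e : m⁻¹ * g ((i:ℝ) / m) = ∫ _ in ((i:ℝ) / m)..(((i + 1 : ℕ):ℝ) / m), g ((i:ℝ) / m) := by
      rw [intervalIntegral.integral_const, hlen, smul_eq_mul]
    rw [e, ← intervalIntegral.integral_sub (by simp) (hii i hi)]
    have := intervalIntegral.norm_integral_le_of_norm_le_const (a := (i:ℝ) / m)
      (b := ((i + 1 : ℕ):ℝ) / m) (C := ε / 2) (f := fun x => g ((i:ℝ) / m) - g x) (fun x hx => by
        rw [uIoc_of_le (hle i)] at hx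
        have hx' : x ∈ Icc ((i:ℝ) / m) (((i + 1 : ℕ):ℝ) / m) := ⟨hx.1.le, hx.2⟩
        have := hgδ _ (hsub i hi ⟨le_rfl, hle i⟩) _ (hsub i hi hx') (by
          rw [Real.dist_eq, abs_sub_comm, abs_of_nonneg (by linarith [hx.1])]
          linarith [hx.2, hlen i])
        rw [Real.dist_eq] at this
        exact this.le)
    rwa [hlen, abs_of_pos (inv_pos.2 hm)] at this
  calc _ ≤ ∑ i ∈ Finset.range (n + 1), _ := Finset.abs_sum_le_sum_abs _ _
    _ ≤ ∑ i ∈ Finset.range (n + 1), ε / 2 * m⁻¹ := Finset.sum_le_sum hterm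
    _ = ε / 2 := by
      rw [Finset.sum_const, Finset.card_range, nsmul_eq_mul]
      push_cast
      rw [← hm_def]; field_simp
    _ < ε := by linarith

/-- Left Riemann sums of a continuous function on a compact interval converge to its integral. -/
lemma tendsto_riemannSum {a b : ℝ} (hab : a ≤ b) {h : ℝ → ℝ} (hh : ContinuousOn h (Icc a b)) :
    Tendsto (fun n : ℕ => (b - a) * ∑ i : Fin (n + 1),
        ((n : ℝ) + 1)⁻¹ * h (a + (b - a) * (i / ((n : ℝ) + 1)))) atTop
      (𝓝 (∫ x in Ioc a b, h x)) := by
  have e : ∫ x in Ioc a b, h x = (b - a) * ∫ x in (0:ℝ)..1, h (a + (b - a) * x) := by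
    have := intervalIntegral.smul_integral_comp_add_mul (a := 0) (b := 1) h (b - a) a
    rw [smul_eq_mul] at this
    rw [this, ← intervalIntegral.integral_of_le hab]
    simp
  rw [e]
  refine (tendsto_riemannSum_unitInterval (g := fun x => h (a + (b - a) * x)) ?_).const_mul _
  refine hh.comp (by fun_prop) fun x hx => ?_
  constructor
  · nlinarith [hx.1, hx.2, mul_nonneg (sub_nonneg.2 hab) hx.1]
  · nlinarith [hx.1, hx.2, mul_nonneg (sub_nonneg.2 hab) (sub_nonneg.2 hx.2)]

lemma riemannPoint_mem_Icc {a b : ℝ} (hab : a ≤ b) (n : ℕ) (i : Fin (n + 1)) :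
    a + (b - a) * (i / ((n : ℝ) + 1)) ∈ Icc a b := by
  have h0 : (0:ℝ) ≤ (i:ℝ) / ((n:ℝ) + 1) := by positivity
  have h1 : (i:ℝ) / ((n:ℝ) + 1) ≤ 1 := by
    rw [div_le_one (by positivity)]
    exact_mod_cast i.2.le
  constructor
  · nlinarith [mul_nonneg (sub_nonneg.2 hab) h0]
  · nlinarith [mul_nonneg (sub_nonneg.2 hab) (sub_nonneg.2 h1)]

/-- The expectation of a bounded continuous function of an integral functional of a continuous
process is a limit of expectations under its finite-dimensional laws. -/
lemma tendsto_integral_map_riemannSum {P : Measure Ω} [IsProbabilityMeasure P]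
    {Z : Ω → ℝ → ℝ} {T : Set ℝ} (mZ : ∀ t ∈ T, Measurable fun ω => Z ω t)
    (cZ : ∀ᵐ ω ∂P, ContinuousOn (Z ω) T) {a b : ℝ} (hab : a ≤ b) (hT : Icc a b ⊆ T)
    {φ : ℝ → ℝ → ℝ} (hφ : ContinuousOn (fun z : ℝ × ℝ => φ z.1 z.2) (Icc a b ×ˢ univ))
    (f : BoundedContinuousFunction ℝ ℝ) (c : ℝ) :
    Tendsto (fun n : ℕ => ∫ x : Fin (n + 1) → ℝ, f (c * ((b - a) * ∑ i : Fin (n + 1),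
        ((n : ℝ) + 1)⁻¹ * φ (a + (b - a) * (i / ((n : ℝ) + 1))) (x i)))
      ∂(P.map fun ω (i : Fin (n + 1)) => Z ω (a + (b - a) * (i / ((n : ℝ) + 1))))) atTop
      (𝓝 (∫ ω, f (c * ∫ t in Ioc a b, φ t (Z ω t)) ∂P)) := by
  have hφm : ∀ t ∈ Icc a b, Continuous (φ t) := fun t ht => by
    rw [← continuousOn_univ]
    exact hφ.comp (f := fun x => (t, x)) (by fun_prop) fun x _ => ⟨ht, mem_univ _⟩
  have hG : ∀ n : ℕ, Continuous fun x : Fin (n + 1) → ℝ => f (c * ((b - a) * ∑ i : Fin (n + 1),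
      ((n : ℝ) + 1)⁻¹ * φ (a + (b - a) * (i / ((n : ℝ) + 1))) (x i))) := fun n => by
    refine f.continuous.comp (continuous_const.mul (continuous_const.mul
      (continuous_finsetSum _ fun i _ => continuous_const.mul ?_)))
    exact (hφm _ (riemannPoint_mem_Icc hab n i)).comp (continuous_apply i)
  have mZ' : ∀ n : ℕ, Measurable fun ω (i : Fin (n + 1)) =>
      Z ω (a + (b - a) * (i / ((n : ℝ) + 1))) :=
    fun n => measurable_pi_lambda _ fun i => mZ _ (hT (riemannPoint_mem_Icc hab n i))
  refine Tendsto.congr (fun n =>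
    (integral_map (mZ' n).aemeasurable (hG n).aestronglyMeasurable).symm) ?_
  refine tendsto_integral_of_dominated_convergence (fun _ => ‖f‖)
    (fun n => ((hG n).measurable.comp (mZ' n)).aestronglyMeasurable) (integrable_const _)
    (fun n => ae_of_all _ fun ω => f.norm_coe_le_norm _) ?_
  filter_upwards [cZ] with ω hω
  refine (f.continuous.tendsto _).comp (Tendsto.const_mul _ ?_)
  exact tendsto_riemannSum hab (h := fun t => φ t (Z ω t))
    (hφ.comp (f := fun t => (t, Z ω t)) (continuousOn_id.prodMk (hω.mono hT))
      fun t ht => ⟨ht, mem_univ _⟩)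

/-- Integral functionals of continuous centred Gaussian processes are determined in law by the
covariance. -/
lemma IsGaussianOn.integral_comp_setIntegral_eq {Ω' : Type*} [MeasurableSpace Ω']
    {P : Measure Ω} {P' : Measure Ω'} [IsProbabilityMeasure P] [IsProbabilityMeasure P']
    {X : Ω → ℝ → ℝ} {Y : Ω' → ℝ → ℝ} {T : Set ℝ}
    (hX : IsGaussianOn P X T) (hY : IsGaussianOn P' Y T)
    (mX : ∀ t ∈ T, Measurable fun ω => X ω t) (mY : ∀ t ∈ T, Measurable fun ω => Y ω t)
    (hcov : ∀ s ∈ T, ∀ t ∈ T, ∫ ω, X ω s * X ω t ∂P = ∫ ω, Y ω s * Y ω t ∂P')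
    (cX : ∀ᵐ ω ∂P, ContinuousOn (X ω) T) (cY : ∀ᵐ ω ∂P', ContinuousOn (Y ω) T)
    {a b : ℝ} (hab : a ≤ b) (hT : Icc a b ⊆ T) {φ : ℝ → ℝ → ℝ}
    (hφ : ContinuousOn (fun z : ℝ × ℝ => φ z.1 z.2) (Icc a b ×ˢ univ))
    (f : BoundedContinuousFunction ℝ ℝ) (c : ℝ) :
    ∫ ω, f (c * ∫ t in Ioc a b, φ t (X ω t)) ∂P
      = ∫ ω, f (c * ∫ t in Ioc a b, φ t (Y ω t)) ∂P' := by
  refine tendsto_nhds_unique (tendsto_integral_map_riemannSum mX cX hab hT hφ f c) ?_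
  refine (tendsto_integral_map_riemannSum mY cY hab hT hφ f c).congr fun n => ?_
  rw [hX.map_eq_map hY mX mY hcov _ fun i => hT (riemannPoint_mem_Icc hab n i)]

lemma integral_eq_zero_of_map_eq_gaussianReal {P : Measure Ω} {Z : Ω → ℝ} {v : NNReal}
    (h : P.map Z = gaussianReal 0 v) : ∫ ω, Z ω ∂P = 0 := by
  have hZ : AEMeasurable Z P := AEMeasurable.of_map_ne_zero (by
    rw [h]; exact NeZero.ne _)
  have h1 : ∫ ω, Z ω ∂P = ∫ x, x ∂(P.map Z) := by
    rw [integral_map hZ (by fun_prop)]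
  rw [h1, h, integral_id_gaussianReal]

/-- A two-sided standard Wiener process with everywhere continuous paths started at `0`. -/
structure IsTwoSidedWiener (P : Measure Ω) (V : Ω → ℝ → ℝ) : Prop where
  meas : ∀ x, Measurable fun ω => V ω x
  cont : ∀ ω, Continuous (V ω)
  zero : ∀ ω, V ω 0 = 0
  gauss : IsGaussianOn P V univ
  cov : ∀ s t, ∫ ω, V ω s * V ω t ∂P = (|s| + |t| - |s - t|) / 2

/-- Two independent Wiener processes can be glued at `0` to a two-sided one. -/
lemma exists_isTwoSidedWiener {P : Measure Ω} {Wa Wb : Ω → ℝ → ℝ}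
    (hWa : IsWienerProcessOn P Wa (Ici 0)) (hWb : IsWienerProcessOn P Wb (Ici 0))
    (hindep : IndepFun Wa Wb P) :
    ∃ V : Ω → ℝ → ℝ, IsTwoSidedWiener P V ∧
      ∀ᵐ ω ∂P, (∀ t, 0 ≤ t → V ω t = Wa ω t) ∧ ∀ t, 0 ≤ t → V ω (-t) = Wb ω t := by
  have hgood : ∀ᵐ ω ∂P, ContinuousOn (Wa ω) (Ici 0) ∧ ContinuousOn (Wb ω) (Ici 0) ∧
      Wa ω 0 = 0 ∧ Wb ω 0 = 0 := by
    filter_upwards [hWa.cont, hWb.cont, hWa.zero, hWb.zero] with ω h1 h2 h3 h4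
    exact ⟨h1, h2, h3, h4⟩
  obtain ⟨G, hGP, hGm, hG⟩ := hgood.exists_measurable_mem
  classical
  let V : Ω → ℝ → ℝ := fun ω x =>
    if ω ∈ G then (if 0 ≤ x then Wa ω x else Wb ω (-x)) else 0
  have hVae : ∀ x, (fun ω => V ω x) =ᵐ[P] fun ω => if 0 ≤ x then Wa ω x else Wb ω (-x) := by
    intro x
    filter_upwards [hGP] with ω hω
    simp [V, hω]
  have neg_mem : ∀ {x : ℝ}, ¬ 0 ≤ x → -x ∈ Ici (0:ℝ) := fun hx => by
    simp only [mem_Ici]; linarith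
  have cross : ∀ s ∈ Ici (0:ℝ), ∀ t ∈ Ici (0:ℝ), ∫ ω, Wa ω s * Wb ω t ∂P = 0 := by
    intro s hs t ht
    obtain ⟨v, hv⟩ := hWa.gauss.exists_map hs
    have hi : IndepFun (fun ω => Wa ω s) (fun ω => Wb ω t) P :=
      hindep.comp (measurable_pi_apply s) (measurable_pi_apply t)
    rw [hi.integral_fun_mul_eq_mul_integral (hWa.meas s hs).aestronglyMeasurable
      (hWb.meas t ht).aestronglyMeasurable, integral_eq_zero_of_map_eq_gaussianReal hv, zero_mul]
  refine ⟨V, ⟨fun x => ?_, fun ω => ?_, fun ω => ?_, ?_, fun s t => ?_⟩, ?_⟩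
  · refine Measurable.ite hGm ?_ measurable_const
    by_cases hx : 0 ≤ x <;> simp only [hx, if_true, if_false]
    · exact hWa.meas x hx
    · exact hWb.meas _ (neg_mem hx)
  · by_cases hω : ω ∈ G
    · obtain ⟨h1, h2, h3, h4⟩ := hG ω hω
      have e : V ω = fun x => if 0 ≤ x then Wa ω (max x 0) else Wb ω (max (-x) 0) := by
        funext x
        by_cases hx : 0 ≤ x
        · simp [V, hω, hx]
        · simp [V, hω, hx, (not_le.1 hx).le]
      rw [e]
      refine Continuous.if_le ?_ ?_ continuous_const continuous_id ?_
      · exact h1.comp_continuous (by fun_prop) fun x => mem_Ici.2 (le_max_right _ _)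
      · exact h2.comp_continuous (by fun_prop) fun x => mem_Ici.2 (le_max_right _ _)
      · rintro x rfl
        simp [h3, h4]
    · simp only [V, hω, if_false]
      exact continuous_const
  · by_cases hω : ω ∈ G
    · simp [V, hω, (hG ω hω).2.2.1]
    · simp [V, hω]
  · intro n t _ c
    obtain ⟨v, hv⟩ := hWa.gauss n (fun i => max (t i) 0) (fun i => mem_Ici.2 (le_max_right _ _))
      (fun i => if 0 ≤ t i then c i else 0)
    obtain ⟨w, hw⟩ := hWb.gauss n (fun i => max (-t i) 0) (fun i => mem_Ici.2 (le_max_right _ _))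
      (fun i => if 0 ≤ t i then 0 else c i)
    have hi := hindep.comp
      (φ := fun x : ℝ → ℝ => ∑ i, (if 0 ≤ t i then c i else 0) * x (max (t i) 0))
      (ψ := fun x : ℝ → ℝ => ∑ i, (if 0 ≤ t i then 0 else c i) * x (max (-t i) 0))
      (Finset.measurable_sum _ fun i _ => (measurable_pi_apply _).const_mul _)
      (Finset.measurable_sum _ fun i _ => (measurable_pi_apply _).const_mul _)
    have hsum := gaussianReal_add_gaussianReal_of_indepFun hi hv hw
    refine ⟨v + w, ?_⟩
    rw [add_zero] at hsum
    rw [← hsum]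
    refine Measure.map_congr ?_
    filter_upwards [hGP] with ω hω
    simp only [Pi.add_apply, Function.comp, ← Finset.sum_add_distrib]
    refine Finset.sum_congr rfl fun i _ => ?_
    by_cases hi : 0 ≤ t i
    · simp [V, hω, hi]
    · simp [V, hω, hi, (not_le.1 hi).le]
  · have e : ∫ ω, V ω s * V ω t ∂P = ∫ ω, (if 0 ≤ s then Wa ω s else Wb ω (-s)) *
        (if 0 ≤ t then Wa ω t else Wb ω (-t)) ∂P :=
      integral_congr_ae ((hVae s).mul (hVae t))
    rw [e]
    have hcase : ∀ x y : ℝ, min x y = (x + y - |x - y|) / 2 := fun x y => by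
      rcases le_total x y with h | h
      · rw [min_eq_left h, abs_of_nonpos (by linarith)]; ring
      · rw [min_eq_right h, abs_of_nonneg (by linarith)]; ring
    by_cases hs : 0 ≤ s <;> by_cases ht : 0 ≤ t <;> simp only [hs, ht, if_true, if_false]
    · rw [hWa.cov s hs t ht, hcase, abs_of_nonneg hs, abs_of_nonneg ht]
    · rw [cross s hs _ (neg_mem ht), abs_of_nonneg hs, abs_of_neg (not_le.1 ht),
        abs_of_nonneg (by linarith)]
      ring
    · have := cross t ht _ (neg_mem hs)
      simp_rw [mul_comm (Wa _ _)] at this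
      rw [this, abs_of_nonneg ht, abs_of_neg (not_le.1 hs), abs_of_nonpos (by linarith)]
      ring
    · rw [hWb.cov _ (neg_mem hs) _ (neg_mem ht), hcase, abs_of_neg (not_le.1 hs),
        abs_of_neg (not_le.1 ht), abs_sub_comm s t]
      congr 3
      ring
  · filter_upwards [hGP] with ω hω
    refine ⟨fun t ht => by simp [V, hω, ht], fun t ht => ?_⟩
    rcases ht.eq_or_lt with rfl | ht
    · simp [V, hω, (hG ω hω).2.2.1, (hG ω hω).2.2.2]
    · simp [V, hω, not_le.2 ht]

/-- Rescaling the two sides of a two-sided Wiener process separately. -/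
lemma IsTwoSidedWiener.rescale {P : Measure Ω} {V : Ω → ℝ → ℝ} (hV : IsTwoSidedWiener P V)
    {α β : ℝ} (hα : 0 < α) (hβ : 0 < β) :
    IsTwoSidedWiener P (fun ω x => if 0 ≤ x then √α * V ω (x / α) else √β * V ω (x / β)) where
  meas x := by
    have := hV.meas
    by_cases hx : 0 ≤ x <;> simp only [hx, if_true, if_false] <;> exact (this _).const_mul _
  cont ω := by
    have := hV.cont ω
    refine Continuous.if_le (by fun_prop) (by fun_prop) (by fun_prop) (by fun_prop) ?_
    rintro x rfl
    simp [hV.zero]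
  zero ω := by simp [hV.zero]
  gauss := by
    refine hV.gauss.of_linear_combination (ι := Unit) (fun x _ => if 0 ≤ x then √α else √β)
      (fun x _ => if 0 ≤ x then x / α else x / β) (fun _ _ _ => mem_univ _) fun t _ ω => ?_
    by_cases ht : 0 ≤ t <;> simp [ht]
  cov s t := by
    have key : ∀ a b x y : ℝ, ∫ ω, (a * V ω x) * (b * V ω y) ∂P
        = a * b * ((|x| + |y| - |x - y|) / 2) := fun a b x y => by
      rw [← hV.cov, ← integral_const_mul]
      exact integral_congr_ae (ae_of_all _ fun ω => by ring)
    have cross : ∀ x y : ℝ, x ≤ 0 → 0 ≤ y → |x| + |y| - |x - y| = 0 := fun x y hx hy => by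
      rw [abs_of_nonpos hx, abs_of_nonneg hy, abs_of_nonpos (by linarith)]; ring
    have same : ∀ a : ℝ, 0 < a → √a * √a * ((|s / a| + |t / a| - |s / a - t / a|) / 2)
        = (|s| + |t| - |s - t|) / 2 := fun a ha => by
      rw [Real.mul_self_sqrt ha.le, ← sub_div, abs_div, abs_div, abs_div, abs_of_pos ha]
      field_simp
    by_cases hs : 0 ≤ s <;> by_cases ht : 0 ≤ t <;> simp only [hs, ht, if_true, if_false, key]
    · exact same α hα
    · rw [abs_sub_comm, add_comm |s / α|, cross _ _ (div_nonpos_of_nonpos_of_nonneg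
        (not_le.1 ht).le hβ.le) (by positivity), abs_sub_comm s, add_comm |s|,
        cross _ _ (not_le.1 ht).le hs]
      simp
    · rw [cross _ _ (div_nonpos_of_nonpos_of_nonneg
        (not_le.1 hs).le hβ.le) (by positivity), cross _ _ (not_le.1 hs).le ht]
      simp
    · exact same β hβ

/-- The slope added to the two halves of a two-sided Wiener process to make them a bridge. -/
def bridgeSlope (U : Ω → ℝ → ℝ) (ω : Ω) (left : Bool) : ℝ :=
  if left then 2 * (U ω (3/4) - 2 * U ω (1/2))
  else 2 * (U ω (3/4) - U ω (1/2) - U ω (-(1/2)))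

/-- A Brownian bridge on `[0, 1]` whose behaviour near `0` and `1` is given by the two sides of a
two-sided Wiener process. -/
def wienerBridge (U : Ω → ℝ → ℝ) (ω : Ω) (t : ℝ) : ℝ :=
  if t ≤ 1/2 then U ω t + t * bridgeSlope U ω true
  else U ω (t - 1) + (1 - t) * bridgeSlope U ω false

lemma IsTwoSidedWiener.measurable_bridgeSlope {P : Measure Ω} {U : Ω → ℝ → ℝ}
    (hU : IsTwoSidedWiener P U) (b : Bool) : Measurable fun ω => bridgeSlope U ω b := by
  have := hU.meas
  cases b <;> simp only [bridgeSlope, if_true, Bool.false_eq_true, if_false]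
  · exact (((this _).sub (this _)).sub (this _)).const_mul _
  · exact ((this _).sub ((this _).const_mul _)).const_mul _

lemma IsTwoSidedWiener.bridgeSlope_sq {P : Measure Ω} {U : Ω → ℝ → ℝ}
    (hU : IsTwoSidedWiener P U) (b : Bool) :
    Integrable (fun ω => bridgeSlope U ω b ^ 2) P ∧ ∫ ω, bridgeSlope U ω b ^ 2 ∂P = 3 := by
  have e : ∀ ω, bridgeSlope U ω b = ∑ j : Fin 3,
      (if b then ![2, -4, 0] else ![2, -2, -2] : Fin 3 → ℝ) j
        * U ω ((![3/4, 1/2, -(1/2)] : Fin 3 → ℝ) j) := by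
    intro ω
    cases b <;> simp [bridgeSlope, Fin.sum_univ_three] <;> ring
  have hint := hU.gauss.integral_sum_mul_sum (![3/4, 1/2, -(1/2)] : Fin 3 → ℝ)
    (fun _ => mem_univ _) (![3/4, 1/2, -(1/2)] : Fin 3 → ℝ) (fun _ => mem_univ _)
    (if b then ![2, -4, 0] else ![2, -2, -2]) (if b then ![2, -4, 0] else ![2, -2, -2])
  obtain ⟨v, hv⟩ := hU.gauss.exists_map_sum (![3/4, 1/2, -(1/2)] : Fin 3 → ℝ)
    (fun _ => mem_univ _) (if b then ![2, -4, 0] else ![2, -2, -2])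
  simp_rw [← e] at hint hv
  refine ⟨(memLp_of_map_eq_gaussianReal hv (q := 2) (by norm_num)).integrable_sq, ?_⟩
  simp_rw [sq]
  rw [hint]
  simp only [hU.cov]
  cases b <;> simp [Fin.sum_univ_three] <;> norm_num [abs_of_nonneg, abs_of_nonpos]

lemma IsTwoSidedWiener.isBrownianBridge_wienerBridge {P : Measure Ω} {U : Ω → ℝ → ℝ}
    (hU : IsTwoSidedWiener P U) : IsBrownianBridge P (wienerBridge U) := by
  let a : ℝ → Fin 4 → ℝ := fun t =>
    if t ≤ 1/2 then ![1, 2 * t, -4 * t, 0] else ![1, 2 * (1 - t), -2 * (1 - t), -2 * (1 - t)]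
  let τ : ℝ → Fin 4 → ℝ := fun t => ![if t ≤ 1/2 then t else t - 1, 3/4, 1/2, -(1/2)]
  have e : ∀ ω t, wienerBridge U ω t = ∑ j, a t j * U ω (τ t j) := by
    intro ω t
    by_cases ht : t ≤ 1/2 <;>
      simp only [a, τ, wienerBridge, bridgeSlope, ht, if_true, if_false, Fin.sum_univ_four,
        Bool.false_eq_true] <;> simp <;> ring
  refine ⟨fun t _ => ?_, ?_, ae_of_all _ fun ω => ?_, fun s hs t ht => ?_⟩
  · have := hU.meas
    simp only [e]
    exact Finset.measurable_sum _ fun j _ => (this _).const_mul _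
  · exact hU.gauss.of_linear_combination a τ (fun _ _ _ => mem_univ _) fun t _ ω => e ω t
  · have := hU.cont ω
    refine Continuous.continuousOn ?_
    refine Continuous.if_le (by fun_prop) (by fun_prop) (by fun_prop) (by fun_prop) ?_
    rintro x rfl
    simp only [bridgeSlope, if_true, Bool.false_eq_true, if_false]
    norm_num
    ring
  · wlog hst : s ≤ t generalizing s t
    · simp_rw [mul_comm (wienerBridge U _ s), this t ht s hs (le_of_not_ge hst), min_comm, mul_comm]
    simp only [e]
    rw [hU.gauss.integral_sum_mul_sum _ (fun _ => mem_univ _) _ (fun _ => mem_univ _)]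
    obtain ⟨K, hK⟩ : ∃ K : ℝ → ℝ → ℝ, ∀ x y, K x y = (|x| + |y| - |x - y|) / 2 :=
      ⟨_, fun _ _ => rfl⟩
    simp only [hU.cov, ← hK, Fin.sum_univ_four]
    have hcomm : ∀ x y, K x y = K y x := fun x y => by
      rw [hK, hK, abs_sub_comm, add_comm |x|]
    have hpos : ∀ x y : ℝ, 0 ≤ x → x ≤ y → K x y = x := fun x y h h' => by
      rw [hK, abs_of_nonneg h, abs_of_nonneg (h.trans h'), abs_of_nonpos (by linarith)]; ring
    have hneg : ∀ x y : ℝ, x ≤ 0 → y ≤ x → K x y = -x := fun x y h h' => by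
      rw [hK, abs_of_nonpos h, abs_of_nonpos (h'.trans h), abs_of_nonneg (by linarith)]; ring
    have hzero : ∀ x y : ℝ, x ≤ 0 → 0 ≤ y → K x y = 0 := fun x y h h' => by
      rw [hK, abs_of_nonpos h, abs_of_nonneg h', abs_of_nonpos (by linarith)]; ring
    have hleft : ∀ x : ℝ, 0 ≤ x → x ≤ 1/2 →
        (a x = ![1, 2 * x, -4 * x, 0] ∧ τ x = ![x, 3/4, 1/2, -(1/2)]) ∧
        (K x (3/4) = x ∧ K x (1/2) = x ∧ K x (-(1/2)) = 0) ∧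
        (K (3/4) x = x ∧ K (1/2) x = x ∧ K (-(1/2)) x = 0) := fun x hx hx' => by
      have h1 := hpos x (3/4) hx (by linarith)
      have h2 := hpos x (1/2) hx hx'
      have h3 := hzero (-(1/2)) x (by norm_num) hx
      refine ⟨by simp only [a, τ, if_pos hx', and_self], ⟨h1, h2, ?_⟩, ?_, ?_, h3⟩ <;>
        rw [hcomm] <;> assumption
    have hright : ∀ x : ℝ, 1/2 < x → x ≤ 1 →
        (a x = ![1, 2 * (1 - x), -2 * (1 - x), -2 * (1 - x)] ∧
          τ x = ![x - 1, 3/4, 1/2, -(1/2)]) ∧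
        (K (x - 1) (3/4) = 0 ∧ K (x - 1) (1/2) = 0 ∧ K (x - 1) (-(1/2)) = -(x - 1)) ∧
        (K (3/4) (x - 1) = 0 ∧ K (1/2) (x - 1) = 0 ∧ K (-(1/2)) (x - 1) = -(x - 1)) :=
      fun x hx hx' => by
      have h1 := hzero (x - 1) (3/4) (by linarith) (by norm_num)
      have h2 := hzero (x - 1) (1/2) (by linarith) (by norm_num)
      have h3 := hneg (x - 1) (-(1/2)) (by linarith) (by linarith)
      refine ⟨by simp only [a, τ, if_neg (not_le.2 hx), and_self], ⟨h1, h2, h3⟩, ?_, ?_, ?_⟩ <;>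
        rw [hcomm] <;> assumption
    have hconst : K (3/4) (3/4) = 3/4 ∧ K (-(1/2)) (-(1/2)) = 1/2 ∧ K (-(1/2)) (3/4) = 0 ∧
        K (3/4) (-(1/2)) = 0 := by
      simp only [hK]
      norm_num [abs_of_nonneg, abs_of_nonpos]
    have hhalf := hleft (1/2) (by norm_num) le_rfl
    obtain ⟨hs0, hs1⟩ := hs
    obtain ⟨ht0, ht1⟩ := ht
    rw [min_eq_left hst]
    rcases le_or_gt s (1/2) with hs2 | hs2 <;> rcases le_or_gt t (1/2) with ht2 | ht2
    · simp only [hleft s hs0 hs2, hleft t ht0 ht2, hpos s t hs0 hst, hconst, hhalf,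
        Matrix.cons_val_zero, Matrix.cons_val_one, Matrix.cons_val]
      ring
    · simp only [hleft s hs0 hs2, hright t ht2 ht1, hcomm s (t - 1),
        hzero (t - 1) s (by linarith) hs0, hconst, hhalf,
        Matrix.cons_val_zero, Matrix.cons_val_one, Matrix.cons_val]
      ring
    · linarith
    · simp only [hright s hs2 hs1, hright t ht2 ht1, hcomm (s - 1) (t - 1),
        hneg (t - 1) (s - 1) (by linarith) (by linarith), hconst, hhalf,
        Matrix.cons_val_zero, Matrix.cons_val_one, Matrix.cons_val]
      ring

/-- The absolute moments of the standard normal distribution. -/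
def gaussianAbsMoment (q : ℝ) : ENNReal := ∫⁻ x, ‖x‖ₑ ^ q ∂(gaussianReal 0 1)

lemma gaussianAbsMoment_ne_top {q : ℝ} (hq : 0 ≤ q) : gaussianAbsMoment q ≠ ⊤ := by
  rcases hq.eq_or_lt with rfl | hq
  · simp [gaussianAbsMoment]
  · have h := lintegral_rpow_enorm_lt_top_of_eLpNorm_lt_top (f := id) (p := (q.toNNReal : ENNReal))
      (by simpa using hq) ENNReal.coe_ne_top
      (memLp_id_gaussianReal (μ := 0) (v := 1) q.toNNReal).eLpNorm_lt_top
    simpa [gaussianAbsMoment, hq.le] using h.ne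

/-- The absolute moments of a centred Gaussian variable are controlled by its variance. -/
lemma lintegral_enorm_rpow_le_of_map_eq_gaussianReal {P : Measure Ω} {Z : Ω → ℝ} {v : NNReal}
    (h : P.map Z = gaussianReal 0 v) {q u : ℝ} (hq : 0 ≤ q) (hv : (v : ℝ) ≤ u) :
    ∫⁻ ω, ‖Z ω‖ₑ ^ q ∂P ≤ ENNReal.ofReal (u ^ (q / 2)) * gaussianAbsMoment q := by
  have hZ : AEMeasurable Z P := AEMeasurable.of_map_ne_zero (by
    rw [h]; exact NeZero.ne _)
  have h1 : ∫⁻ ω, ‖Z ω‖ₑ ^ q ∂P = ∫⁻ x, ‖x‖ₑ ^ q ∂(P.map Z) := by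
    rw [lintegral_map' (by fun_prop) hZ]
  have h2 : gaussianReal 0 v = (gaussianReal 0 1).map (fun x => √(v : ℝ) * x) := by
    rw [gaussianReal_map_const_mul]
    congr 1
    · simp
    · ext
      simp
  rw [h1, h, h2, lintegral_map (by fun_prop) (by fun_prop)]
  simp_rw [enorm_mul, ENNReal.mul_rpow_of_nonneg _ _ hq]
  rw [lintegral_const_mul _ (by fun_prop)]
  refine mul_le_mul_left ?_ _
  rw [Real.enorm_eq_ofReal (Real.sqrt_nonneg _), ENNReal.ofReal_rpow_of_nonneg
    (Real.sqrt_nonneg _) hq, Real.sqrt_eq_rpow, ← Real.rpow_mul v.coe_nonneg]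
  refine ENNReal.ofReal_le_ofReal ?_
  rw [one_div_mul_eq_div]
  exact Real.rpow_le_rpow v.coe_nonneg hv (by positivity)

lemma abs_abs_rpow_sub_abs_rpow_le {p : ℝ} (hp : 1 ≤ p) (a b : ℝ) :
    |(|a| ^ p - |b| ^ p)| ≤ p * (|a| ^ (p - 1) + |b| ^ (p - 1)) * |a - b| := by
  have hmax : max |a| |b| ^ (p - 1) ≤ |a| ^ (p - 1) + |b| ^ (p - 1) := by
    rcases max_cases |a| |b| with h | h <;> rw [h.1] <;> simp only [le_add_iff_nonneg_right,
      le_add_iff_nonneg_left] <;> positivity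
  have h := Convex.norm_image_sub_le_of_norm_hasDerivWithin_le
    (f := fun x : ℝ => x ^ p) (f' := fun x => p * x ^ (p - 1)) (s := Icc 0 (max |a| |b|))
    (x := |b|) (y := |a|) (C := p * (|a| ^ (p - 1) + |b| ^ (p - 1)))
    (fun x _ => (Real.hasDerivAt_rpow_const (Or.inr hp)).hasDerivWithinAt)
    (fun x hx => by
      have := hx.1
      rw [Real.norm_of_nonneg (by positivity)]
      gcongr
      exact (Real.rpow_le_rpow hx.1 hx.2 (by linarith)).trans hmax)
    (convex_Icc _ _) ⟨abs_nonneg _, le_max_right _ _⟩ ⟨abs_nonneg _, le_max_left _ _⟩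
  refine h.trans ?_
  gcongr
  exact abs_abs_sub_abs_le a b

lemma enorm_abs_rpow_sub_abs_rpow_le {p : ℝ} (hp : 1 ≤ p) (a b : ℝ) :
    ‖|a| ^ p - |b| ^ p‖ₑ
      ≤ ‖a - b‖ₑ * (ENNReal.ofReal p * (‖a‖ₑ ^ (p - 1) + ‖b‖ₑ ^ (p - 1))) := by
  have e : ∀ x : ℝ, ‖x‖ₑ ^ (p - 1) = ENNReal.ofReal (|x| ^ (p - 1)) := fun x => by
    rw [Real.enorm_eq_ofReal_abs, ENNReal.ofReal_rpow_of_nonneg (abs_nonneg _) (by linarith)]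
  rw [e, e, ← ENNReal.ofReal_add (by positivity) (by positivity),
    ← ENNReal.ofReal_mul (by linarith), Real.enorm_eq_ofReal_abs, Real.enorm_eq_ofReal_abs,
    ← ENNReal.ofReal_mul (abs_nonneg _)]
  refine ENNReal.ofReal_le_ofReal ?_
  rw [mul_comm |a - b|]
  exact abs_abs_rpow_sub_abs_rpow_le hp a b

/-- The `L¹` distance between the `p`-th powers of two Gaussian variables is controlled by their
`L²` distance. -/
lemma lintegral_enorm_abs_rpow_sub_le {P : Measure Ω} {Z Z' : Ω → ℝ} {v v' : NNReal}
    (hZ : Measurable Z) (hZ' : Measurable Z')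
    (h : P.map Z = gaussianReal 0 v) (h' : P.map Z' = gaussianReal 0 v') {p u : ℝ} (hp : 1 ≤ p)
    (hv : (v : ℝ) ≤ u) (hv' : (v' : ℝ) ≤ u) :
    ∫⁻ ω, ‖|Z ω| ^ p - |Z' ω| ^ p‖ₑ ∂P ≤ (∫⁻ ω, ‖Z ω - Z' ω‖ₑ ^ (2 : ℝ) ∂P) ^ (1 / 2 : ℝ) *
      (ENNReal.ofReal p ^ (2 : ℝ) * (2 * (2 * (ENNReal.ofReal (u ^ (p - 1)) *
        gaussianAbsMoment (2 * (p - 1)))))) ^ (1 / 2 : ℝ) := by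
  refine (lintegral_mono fun ω => enorm_abs_rpow_sub_abs_rpow_le hp (Z ω) (Z' ω)).trans ?_
  refine (ENNReal.lintegral_mul_le_Lp_mul_Lq P (p := 2) (q := 2) Real.HolderConjugate.two_two
    (f := fun ω => ‖Z ω - Z' ω‖ₑ)
    (g := fun ω => ENNReal.ofReal p * (‖Z ω‖ₑ ^ (p - 1) + ‖Z' ω‖ₑ ^ (p - 1)))
    (by fun_prop) (by fun_prop)).trans ?_
  gcongr
  have hmom : ∀ {Z : Ω → ℝ} {v : NNReal}, P.map Z = gaussianReal 0 v → (v : ℝ) ≤ u →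
      ∫⁻ ω, (‖Z ω‖ₑ ^ (p - 1)) ^ (2 : ℝ) ∂P
        ≤ ENNReal.ofReal (u ^ (p - 1)) * gaussianAbsMoment (2 * (p - 1)) := fun h hv => by
    have := lintegral_enorm_rpow_le_of_map_eq_gaussianReal h (q := 2 * (p - 1)) (by linarith) hv
    simp_rw [← ENNReal.rpow_mul, mul_comm (p - 1)]
    rwa [mul_div_cancel_left₀ _ (by norm_num)] at this
  calc ∫⁻ ω, (ENNReal.ofReal p * (‖Z ω‖ₑ ^ (p - 1) + ‖Z' ω‖ₑ ^ (p - 1))) ^ (2 : ℝ) ∂P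
      ≤ ∫⁻ ω, ENNReal.ofReal p ^ (2 : ℝ) *
          (2 * ((‖Z ω‖ₑ ^ (p - 1)) ^ (2 : ℝ) + (‖Z' ω‖ₑ ^ (p - 1)) ^ (2 : ℝ))) ∂P := by
        refine lintegral_mono fun ω => ?_
        rw [ENNReal.mul_rpow_of_nonneg _ _ (by norm_num)]
        gcongr
        refine (ENNReal.rpow_add_le_mul_rpow_add_rpow _ _ (by norm_num)).trans_eq ?_
        norm_num
    _ = ENNReal.ofReal p ^ (2 : ℝ) * (2 * (∫⁻ ω, (‖Z ω‖ₑ ^ (p - 1)) ^ (2 : ℝ) ∂P +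
          ∫⁻ ω, (‖Z' ω‖ₑ ^ (p - 1)) ^ (2 : ℝ) ∂P)) := by
        rw [lintegral_const_mul _ (by fun_prop), lintegral_const_mul _ (by fun_prop),
          lintegral_add_left (by fun_prop)]
    _ ≤ _ := by
        gcongr
        rw [two_mul]
        exact add_le_add (hmom h hv) (hmom h' hv')

/-- The integrand of the perturbed functional, cut off where the perturbation is not small. -/
def perturbedIntegrand (p κ τ : ℝ) (W : Ω → ℝ → ℝ) (Y : Ω → ℝ) (ω : Ω) (u : ℝ) : ℝ :=
  (Ioc 1 (1 / (2 * τ))).indicator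
    (fun u => |W ω u + √τ * u * Y ω| ^ p / (u * (1 - τ * u)) ^ κ) u

lemma measurable_perturbedIntegrand {p κ τ : ℝ} {W : Ω → ℝ → ℝ} {Y : Ω → ℝ}
    (hW : Measurable (Function.uncurry W)) (hY : Measurable Y) :
    Measurable (Function.uncurry (perturbedIntegrand p κ τ W Y)) := by
  have hS : MeasurableSet {z : Ω × ℝ | z.2 ∈ Ioc 1 (1 / (2 * τ))} :=
    measurable_snd measurableSet_Ioc
  have e : Function.uncurry (perturbedIntegrand p κ τ W Y) =
      {z : Ω × ℝ | z.2 ∈ Ioc 1 (1 / (2 * τ))}.indicator fun z =>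
        |Function.uncurry W z + √τ * z.2 * Y z.1| ^ p / (z.2 * (1 - τ * z.2)) ^ κ := by
    ext ⟨ω, u⟩
    simp [perturbedIntegrand, Function.uncurry, indicator]
  rw [e]
  refine Measurable.indicator ?_ hS
  fun_prop

lemma lintegral_enorm_abs_rpow_div_le {P : Measure Ω} {Z : Ω → ℝ} {v : NNReal}
    (h : P.map Z = gaussianReal 0 v) {p κ u c : ℝ} (hp : 0 ≤ p) (hκ : 0 ≤ κ) (hu : 0 < u)
    (hv : (v : ℝ) ≤ u) (hc : 1 / 2 ≤ c) :
    ∫⁻ ω, ‖|Z ω| ^ p / (u * c) ^ κ‖ₑ ∂P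
      ≤ ENNReal.ofReal (2 ^ κ * u ^ (p / 2 - κ)) * gaussianAbsMoment p := by
  have e : ∀ ω, ‖|Z ω| ^ p / (u * c) ^ κ‖ₑ = ENNReal.ofReal (((u * c) ^ κ)⁻¹) * ‖Z ω‖ₑ ^ p := by
    intro ω
    rw [div_eq_inv_mul, enorm_mul, Real.enorm_rpow_of_nonneg (abs_nonneg _) hp,
      Real.enorm_of_nonneg (by positivity)]
    simp
  simp_rw [e]
  rw [lintegral_const_mul' _ _ ENNReal.ofReal_ne_top]
  refine (mul_le_mul_right (lintegral_enorm_rpow_le_of_map_eq_gaussianReal h hp hv) _).trans ?_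
  rw [← mul_assoc, ← ENNReal.ofReal_mul (by positivity)]
  refine mul_le_mul_left (ENNReal.ofReal_le_ofReal ?_) _
  rw [Real.rpow_sub hu, Real.mul_rpow hu.le (by linarith), mul_inv,
    div_eq_mul_inv (u ^ (p / 2))]
  have : (c ^ κ)⁻¹ ≤ 2 ^ κ := by
    rw [← Real.inv_rpow (by linarith)]
    refine Real.rpow_le_rpow (inv_nonneg.2 (by linarith)) ?_ hκ
    rw [inv_le_comm₀ (by linarith) (by norm_num)]
    linarith
  calc (u ^ κ)⁻¹ * (c ^ κ)⁻¹ * u ^ (p / 2) ≤ (u ^ κ)⁻¹ * 2 ^ κ * u ^ (p / 2) := by gcongr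
    _ = _ := by ring

/-- The weighted `p`-th power functional of a slightly perturbed Wiener process converges in `L¹`
to the one of the Wiener process. -/
lemma tendsto_lintegral_enorm_perturbed {P : Measure Ω} [IsProbabilityMeasure P] {p κ : ℝ}
    (hp : 1 ≤ p) (hκ : p / 2 + 1 < κ) {W : Ω → ℝ → ℝ} (hW : Measurable (Function.uncurry W))
    (hWlaw : ∀ u, 1 ≤ u → ∃ v : NNReal, (v : ℝ) ≤ u ∧ P.map (fun ω => W ω u) = gaussianReal 0 v)
    {τ : ℕ → ℝ} (hτ0 : ∀ N, 0 < τ N) (hτ : Tendsto τ atTop (𝓝 0))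
    {Y : ℕ → Ω → ℝ} (hY : ∀ N, Measurable (Y N)) {C : ENNReal} (hC : C ≠ ⊤)
    (hYsq : ∀ N, ∫⁻ ω, ‖Y N ω‖ₑ ^ (2 : ℝ) ∂P ≤ C)
    (hlaw : ∀ N u, 1 ≤ u → τ N * u ≤ 1 / 2 → ∃ v : NNReal, (v : ℝ) ≤ u ∧
      P.map (fun ω => W ω u + √(τ N) * u * Y N ω) = gaussianReal 0 v) :
    Tendsto (fun N => ∫⁻ ω, ‖(∫ u in Ioc 1 (1 / (2 * τ N)),
        |W ω u + √(τ N) * u * Y N ω| ^ p / (u * (1 - τ N * u)) ^ κ)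
          - ∫ u in Ioi (1 : ℝ), |W ω u| ^ p / u ^ κ‖ₑ ∂P) atTop (𝓝 0) := by
  have hp0 : 0 ≤ p := by linarith
  have hκ0 : 0 ≤ κ := by linarith
  set ν : Measure ℝ := volume.restrict (Ioi 1) with hν
  let F : ℕ → Ω → ℝ → ℝ := fun N => perturbedIntegrand p κ (τ N) W (Y N)
  let F₀ : Ω → ℝ → ℝ := fun ω u => |W ω u| ^ p / u ^ κ
  let bnd : ℝ → ENNReal := fun u => ENNReal.ofReal (2 ^ κ * u ^ (p / 2 - κ)) * gaussianAbsMoment p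
  have hFm : ∀ N, Measurable (Function.uncurry (F N)) := fun N =>
    measurable_perturbedIntegrand hW (hY N)
  have hF₀m : Measurable (Function.uncurry F₀) := by
    have e : Function.uncurry F₀ = fun z => |Function.uncurry W z| ^ p / z.2 ^ κ := rfl
    rw [e]; fun_prop
  have hmem : ∀ N u, u ∈ Ioc 1 (1 / (2 * τ N)) ↔ 1 < u ∧ τ N * u ≤ 1 / 2 := fun N u => by
    have := hτ0 N
    rw [mem_Ioc, le_div_iff₀ (by positivity)]
    constructor <;> rintro ⟨h1, h2⟩ <;> exact ⟨h1, by linarith⟩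
  have hbnd : ∫⁻ u, bnd u ∂ν ≠ ⊤ := by
    have hint : IntegrableOn (fun u : ℝ => 2 ^ κ * u ^ (p / 2 - κ)) (Ioi 1) :=
      (integrableOn_Ioi_rpow_of_lt (by linarith) one_pos).const_mul _
    rw [lintegral_mul_const' _ _ (gaussianAbsMoment_ne_top hp0)]
    refine ENNReal.mul_ne_top ?_ (gaussianAbsMoment_ne_top hp0)
    exact (Integrable.lintegral_lt_top hint).ne
  have hF₀bnd : ∀ u, 1 < u → ∫⁻ ω, ‖F₀ ω u‖ₑ ∂P ≤ bnd u := fun u hu => by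
    obtain ⟨v, hv, h⟩ := hWlaw u hu.le
    simpa using lintegral_enorm_abs_rpow_div_le (κ := κ) h hp0 hκ0 (by linarith) hv
      (c := 1) (by norm_num)
  have hFbnd : ∀ N u, 1 < u → ∫⁻ ω, ‖F N ω u‖ₑ ∂P ≤ bnd u := fun N u hu => by
    by_cases huN : u ∈ Ioc 1 (1 / (2 * τ N))
    · have huN' := (hmem N u).1 huN
      obtain ⟨v, hv, h⟩ := hlaw N u hu.le huN'.2
      simp only [F, perturbedIntegrand, indicator_of_mem huN]
      exact lintegral_enorm_abs_rpow_div_le h hp0 hκ0 (by linarith) hv (by linarith [huN'.2])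
    · simp only [F, perturbedIntegrand, indicator_of_notMem huN, enorm_zero, lintegral_zero,
        zero_le]
  have hpath : ∀ {G : Ω → ℝ → ℝ}, Measurable (Function.uncurry G) →
      (∀ u, 1 < u → ∫⁻ ω, ‖G ω u‖ₑ ∂P ≤ bnd u) → ∀ᵐ ω ∂P, Integrable (G ω) ν := by
    intro G hG hGb
    have hle : ∫⁻ ω, ∫⁻ u, ‖G ω u‖ₑ ∂ν ∂P ≤ ∫⁻ u, bnd u ∂ν := by
      rw [lintegral_lintegral_swap hG.enorm.aemeasurable]
      exact lintegral_mono_ae ((ae_restrict_mem measurableSet_Ioi).mono fun u hu => hGb u hu)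
    filter_upwards [ae_lt_top (hG.enorm.lintegral_prod_right')
      (ne_top_of_le_ne_top hbnd hle)] with ω hω
    exact ⟨(hG.comp measurable_prodMk_left).aestronglyMeasurable, hω⟩
  have hle : ∀ N, ∫⁻ ω, ‖(∫ u in Ioc 1 (1 / (2 * τ N)),
        |W ω u + √(τ N) * u * Y N ω| ^ p / (u * (1 - τ N * u)) ^ κ)
          - ∫ u in Ioi (1 : ℝ), |W ω u| ^ p / u ^ κ‖ₑ ∂P
      ≤ ∫⁻ u, ∫⁻ ω, ‖F N ω u - F₀ ω u‖ₑ ∂P ∂ν := by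
    intro N
    rw [← lintegral_lintegral_swap ((hFm N).sub hF₀m).enorm.aemeasurable]
    refine lintegral_mono_ae ?_
    filter_upwards [hpath (hFm N) (hFbnd N), hpath hF₀m hF₀bnd] with ω h1 h2
    refine le_trans (le_of_eq ?_) (enorm_integral_le_lintegral_enorm _)
    rw [integral_sub h1 h2]
    congr 2
    simp only [F, perturbedIntegrand, hν]
    rw [setIntegral_indicator measurableSet_Ioc, inter_eq_right.2 Ioc_subset_Ioi_self]
  refine tendsto_of_tendsto_of_tendsto_of_le_of_le tendsto_const_nhds ?_ (fun _ => zero_le) hle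
  rw [← lintegral_zero (μ := ν)]
  refine tendsto_lintegral_of_dominated_convergence (fun u => bnd u + bnd u)
    (fun N => ((hFm N).sub hF₀m).enorm.lintegral_prod_left') (fun N => ?_) ?_ ?_
  · refine (ae_restrict_mem measurableSet_Ioi).mono fun u hu => ?_
    refine le_trans ?_ (add_le_add (hFbnd N u hu) (hF₀bnd u hu))
    have hm : Measurable fun ω => ‖F N ω u‖ₑ := ((hFm N).comp measurable_prodMk_right).enorm
    rw [← lintegral_add_left hm]
    exact lintegral_mono fun ω => enorm_sub_le
  · rw [lintegral_add_left (by fun_prop)]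
    exact ENNReal.add_ne_top.2 ⟨hbnd, hbnd⟩
  · refine (ae_restrict_mem measurableSet_Ioi).mono fun u hu => ?_
    have hu1 : 1 < u := hu
    obtain ⟨w, hw, hWu⟩ := hWlaw u hu1.le
    have hWm : Measurable fun ω => W ω u := hW.comp measurable_prodMk_right
    set c : ℕ → ℝ := fun N => ((u * (1 - τ N * u)) ^ κ)⁻¹ with hc
    have hclim : Tendsto c atTop (𝓝 (u ^ κ)⁻¹) := by
      have h1 : Tendsto (fun N => u * (1 - τ N * u)) atTop (𝓝 u) := by
        simpa using ((hτ.mul_const u).const_sub 1).const_mul u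
      exact (h1.rpow_const (Or.inl (by positivity))).inv₀ (by positivity)
    set K : ENNReal := (ENNReal.ofReal p ^ (2 : ℝ) * (2 * (2 * (ENNReal.ofReal (u ^ (p - 1)) *
        gaussianAbsMoment (2 * (p - 1)))))) ^ (1 / 2 : ℝ) with hK
    have hKtop : K ≠ ⊤ := by
      have := gaussianAbsMoment_ne_top (q := 2 * (p - 1)) (by linarith)
      refine ENNReal.rpow_ne_top_of_nonneg (by norm_num) ?_
      refine ENNReal.mul_ne_top (ENNReal.rpow_ne_top_of_nonneg (by norm_num) ENNReal.ofReal_ne_top) ?_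
      refine ENNReal.mul_ne_top (by norm_num) (ENNReal.mul_ne_top (by norm_num) ?_)
      exact ENNReal.mul_ne_top ENNReal.ofReal_ne_top this
    have hmom : ∫⁻ ω, ‖|W ω u| ^ p‖ₑ ∂P ≠ ⊤ := by
      simp_rw [Real.enorm_rpow_of_nonneg (abs_nonneg _) hp0, Real.enorm_abs]
      exact ne_top_of_le_ne_top
        (ENNReal.mul_ne_top ENNReal.ofReal_ne_top (gaussianAbsMoment_ne_top hp0))
        (lintegral_enorm_rpow_le_of_map_eq_gaussianReal hWu hp0 hw)
    have hup : ∀ᶠ N in atTop, ∫⁻ ω, ‖F N ω u - F₀ ω u‖ₑ ∂P ≤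
        ‖c N‖ₑ * ((‖√(τ N) * u‖ₑ ^ (2 : ℝ) * C) ^ (1 / 2 : ℝ) * K)
          + ‖c N - (u ^ κ)⁻¹‖ₑ * ∫⁻ ω, ‖|W ω u| ^ p‖ₑ ∂P := by
      have hsmall : ∀ᶠ N in atTop, τ N * u < 1 / 2 :=
        (hτ.mul_const u).eventually_lt_const (by norm_num)
      filter_upwards [hsmall] with N hN
      obtain ⟨v, hv, hZ⟩ := hlaw N u hu1.le hN.le
      have hZm : Measurable fun ω => W ω u + √(τ N) * u * Y N ω := hWm.add ((hY N).const_mul _)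
      have hdiff := lintegral_enorm_abs_rpow_sub_le hZm hWm hZ hWu hp hv hw
      have hsq : ∫⁻ ω, ‖W ω u + √(τ N) * u * Y N ω - W ω u‖ₑ ^ (2 : ℝ) ∂P
          ≤ ‖√(τ N) * u‖ₑ ^ (2 : ℝ) * C := by
        simp_rw [add_sub_cancel_left, enorm_mul _ (Y N _),
          ENNReal.mul_rpow_of_nonneg _ _ (show (0 : ℝ) ≤ 2 by norm_num)]
        rw [lintegral_const_mul _ (by fun_prop)]
        gcongr
        exact hYsq N
      have hmem' : u ∈ Ioc 1 (1 / (2 * τ N)) := (hmem N u).2 ⟨hu1, hN.le⟩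
      calc ∫⁻ ω, ‖F N ω u - F₀ ω u‖ₑ ∂P
          ≤ ∫⁻ ω, (‖c N‖ₑ * ‖|W ω u + √(τ N) * u * Y N ω| ^ p - |W ω u| ^ p‖ₑ
              + ‖c N - (u ^ κ)⁻¹‖ₑ * ‖|W ω u| ^ p‖ₑ) ∂P := by
            refine lintegral_mono fun ω => ?_
            rw [← enorm_mul, ← enorm_mul]
            refine le_trans (le_of_eq ?_) (enorm_add_le _ _)
            simp only [F, F₀, perturbedIntegrand, indicator_of_mem hmem', hc]
            congr 1
            ring
        _ = ‖c N‖ₑ * ∫⁻ ω, ‖|W ω u + √(τ N) * u * Y N ω| ^ p - |W ω u| ^ p‖ₑ ∂P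
              + ‖c N - (u ^ κ)⁻¹‖ₑ * ∫⁻ ω, ‖|W ω u| ^ p‖ₑ ∂P := by
            rw [lintegral_add_left (by fun_prop), lintegral_const_mul _ (by fun_prop),
              lintegral_const_mul _ (by fun_prop)]
        _ ≤ _ := by
            gcongr
            refine hdiff.trans ?_
            gcongr
    refine tendsto_of_tendsto_of_tendsto_of_le_of_le' tendsto_const_nhds ?_
      (Eventually.of_forall fun _ => zero_le) hup
    have l1 : Tendsto (fun N => (‖√(τ N) * u‖ₑ ^ (2 : ℝ) * C) ^ (1 / 2 : ℝ)) atTop (𝓝 0) := by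
      have h1 : Tendsto (fun N => ‖√(τ N) * u‖ₑ) atTop (𝓝 0) := by
        simpa using ((Real.continuous_sqrt.tendsto' 0 0 (by simp)).comp hτ |>.mul_const u).enorm
      have h2 := ENNReal.Tendsto.mul_const (h1.ennrpow_const 2) (Or.inr hC)
      simpa using h2.ennrpow_const (1 / 2)
    have l2 := ENNReal.Tendsto.mul hclim.enorm (Or.inr (by simp))
      (ENNReal.Tendsto.mul_const l1 (Or.inr hKtop)) (Or.inr (by simp))
    have l3 : Tendsto (fun N => ‖c N - (u ^ κ)⁻¹‖ₑ) atTop (𝓝 0) := by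
      simpa using (hclim.sub_const (u ^ κ)⁻¹).enorm
    simpa using l2.add (ENNReal.Tendsto.mul_const l3 (Or.inr hmom))

lemma wienerBridge_of_half_le {Ω : Type*} {U : Ω → ℝ → ℝ} {ω : Ω} {t : ℝ} (ht : 1 / 2 ≤ t) :
    wienerBridge U ω t = U ω (t - 1) + (1 - t) * bridgeSlope U ω false := by
  rcases ht.eq_or_lt with rfl | h
  · simp only [wienerBridge, bridgeSlope, le_refl, if_true]
    norm_num
    ring
  · rw [wienerBridge, if_neg (not_le.2 h)]

lemma IsBrownianBridge.exists_map_of_eq_sqrt_mul {P : Measure Ω} {B : Ω → ℝ → ℝ}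
    (hB : IsBrownianBridge P B) {Z : Ω → ℝ} {τ t u : ℝ} (hτ : 0 < τ) (ht : t ∈ Icc (0 : ℝ) 1)
    (htu : t * (1 - t) ≤ τ * u) (hZ : ∀ ω, B ω t = √τ * Z ω) :
    ∃ v : NNReal, (v : ℝ) ≤ u ∧ P.map Z = gaussianReal 0 v := by
  obtain ⟨v, hv⟩ := hB.gauss.exists_map ht
  have hvar := integral_mul_self_of_map_eq_gaussianReal hv
  rw [hB.cov t ht t ht, min_self] at hvar
  have hZ' : Z = fun ω => (√τ)⁻¹ * B ω t := by
    funext ω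
    rw [hZ, inv_mul_cancel_left₀ (Real.sqrt_pos.2 hτ).ne']
  refine ⟨NNReal.mk (((√τ)⁻¹) ^ 2) (sq_nonneg _) * v, ?_, ?_⟩
  · rw [NNReal.coe_mul, NNReal.coe_mk, inv_pow, Real.sq_sqrt hτ.le, inv_mul_le_iff₀ hτ, ← hvar]
    linarith
  · rw [hZ', show (fun ω => (√τ)⁻¹ * B ω t) = ((√τ)⁻¹ * ·) ∘ (fun ω => B ω t) from rfl,
      ← Measure.map_map (by fun_prop) (hB.meas t ht), hv, gaussianReal_map_const_mul]
    simp

lemma IsTwoSidedWiener.map_eq {P : Measure Ω} {V : Ω → ℝ → ℝ} (hV : IsTwoSidedWiener P V)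
    (x : ℝ) : ∃ v : NNReal, (v : ℝ) = |x| ∧ P.map (fun ω => V ω x) = gaussianReal 0 v := by
  obtain ⟨v, hv⟩ := hV.gauss.exists_map (mem_univ x)
  refine ⟨v, ?_, hv⟩
  rw [← integral_mul_self_of_map_eq_gaussianReal hv, hV.cov]
  simp

lemma IsTwoSidedWiener.measurable_uncurry {P : Measure Ω} {V : Ω → ℝ → ℝ}
    (hV : IsTwoSidedWiener P V) : Measurable (Function.uncurry V) :=
  (measurable_uncurry_of_continuous_of_measurable (u := fun x ω => V ω x)
    hV.cont hV.meas).comp measurable_swap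

/-- Brownian scaling of the weighted `p`-th power functional. -/
lemma setIntegral_weighted_scale {p κ α : ℝ} (hα : 0 < α) (hα' : α ≤ 1 / 2) {X Z : ℝ → ℝ}
    (hXZ : ∀ u, 0 < u → α * u ≤ 1 / 2 → X (α * u) = √α * Z u) :
    ∫ t in Ioc α (1 / 2), |X t| ^ p / (t * (1 - t)) ^ κ =
      α ^ (-(κ - p / 2 - 1)) *
        ∫ u in Ioc 1 (1 / (2 * α)), |Z u| ^ p / (u * (1 - α * u)) ^ κ := by
  have h1 : 1 ≤ 1 / (2 * α) := by rw [le_div_iff₀ (by positivity)]; linarith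
  rw [← intervalIntegral.integral_of_le hα', ← intervalIntegral.integral_of_le h1]
  have key := intervalIntegral.mul_integral_comp_mul_left (a := 1) (b := 1 / (2 * α))
    (f := fun t => |X t| ^ p / (t * (1 - t)) ^ κ) α
  rw [mul_one, show α * (1 / (2 * α)) = 1 / 2 by field_simp] at key
  rw [← key, ← intervalIntegral.integral_const_mul, ← intervalIntegral.integral_const_mul]
  refine intervalIntegral.integral_congr fun u hu => ?_
  rw [uIcc_of_le h1, mem_Icc, le_div_iff₀ (by positivity)] at hu
  have hu0 : 0 < u := by linarith
  have hu1 : α * u ≤ 1 / 2 := by linarith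
  rw [hXZ u hu0 hu1, abs_mul, abs_of_nonneg (Real.sqrt_nonneg _),
    Real.mul_rpow (Real.sqrt_nonneg _) (abs_nonneg _), mul_assoc α u,
    Real.mul_rpow hα.le (mul_nonneg hu0.le (by linarith)), Real.sqrt_eq_rpow,
    ← Real.rpow_mul hα.le, show -(κ - p / 2 - 1) = 1 + (1 / 2 * p) - κ by ring,
    Real.rpow_sub hα, Real.rpow_add hα, Real.rpow_one]
  have := (Real.rpow_pos_of_pos hα κ).ne'
  have : 0 < 1 - α * u := by linarith
  have := (Real.rpow_pos_of_pos (mul_pos hu0 this) κ).ne'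
  field_simp

lemma setIntegral_weighted_reflect {p κ s : ℝ} (hs : 1 / 2 ≤ s) (X : ℝ → ℝ) :
    ∫ t in Ioc (1 / 2) s, |X t| ^ p / (t * (1 - t)) ^ κ =
      ∫ t in Ioc (1 - s) (1 / 2), |X (1 - t)| ^ p / (t * (1 - t)) ^ κ := by
  rw [← intervalIntegral.integral_of_le hs, ← intervalIntegral.integral_of_le (by linarith)]
  have key := intervalIntegral.integral_comp_sub_left (a := 1 - s) (b := 1 / 2)
    (fun t => |X t| ^ p / (t * (1 - t)) ^ κ) 1
  rw [sub_sub_cancel, show (1 : ℝ) - 1 / 2 = 1 / 2 by norm_num] at key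
  rw [← key]
  refine intervalIntegral.integral_congr fun t _ => ?_
  simp only [sub_sub_cancel, mul_comm]

lemma continuousOn_weighted {p κ a b : ℝ} (hp : 0 ≤ p) (ha : 0 < a) (hb : b < 1) :
    ContinuousOn (fun z : ℝ × ℝ => |z.2| ^ p / (z.1 * (1 - z.1)) ^ κ) (Icc a b ×ˢ univ) := by
  have hpos : ∀ z ∈ Icc a b ×ˢ (univ : Set ℝ), z.1 * (1 - z.1) ≠ 0 := by
    rintro z ⟨⟨h1, h2⟩, -⟩
    exact (mul_pos (by linarith) (by linarith)).ne'
  refine ContinuousOn.div ?_ ?_ fun z hz => ?_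
  · exact ContinuousOn.rpow_const (by fun_prop) fun z _ => Or.inr hp
  · exact ContinuousOn.rpow_const (by fun_prop) fun z hz => Or.inl (hpos z hz)
  · obtain ⟨⟨h1, h2⟩, -⟩ := hz
    exact (Real.rpow_pos_of_pos (mul_pos (by linarith) (by linarith)) κ).ne'

/-- Linear combinations, with converging coefficients, of sequences converging in `L¹` converge
in distribution. -/
lemma tendsto_integral_comp_linearCombination {P : Measure Ω} [IsProbabilityMeasure P]
    {J J' : ℕ → Ω → ℝ} {L L' : Ω → ℝ} (hJ : ∀ N, Measurable (J N)) (hJ' : ∀ N, Measurable (J' N))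
    (hL : Measurable L) (hL' : Measurable L')
    (h : Tendsto (fun N => ∫⁻ ω, ‖J N ω - L ω‖ₑ ∂P) atTop (𝓝 0))
    (h' : Tendsto (fun N => ∫⁻ ω, ‖J' N ω - L' ω‖ₑ ∂P) atTop (𝓝 0))
    {a b : ℕ → ℝ} {α β : ℝ} (ha : Tendsto a atTop (𝓝 α)) (hb : Tendsto b atTop (𝓝 β))
    (f : BoundedContinuousFunction ℝ ℝ) :
    Tendsto (fun N => ∫ ω, f (a N * J N ω + b N * J' N ω) ∂P) atTop
      (𝓝 (∫ x, f x ∂(P.map fun ω => α * L ω + β * L' ω))) := by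
  have hlim : TendstoInDistribution (fun N ω => a N * L ω + b N * L' ω) atTop
      (fun ω => α * L ω + β * L' ω) (fun _ => P) P :=
    tendstoInDistribution_of_ae_tendsto (fun N => by fun_prop) (by fun_prop)
      (Eventually.of_forall fun ω => (ha.mul_const _).add (hb.mul_const _))
  have hdiff : TendstoInMeasure P ((fun N ω => a N * J N ω + b N * J' N ω) -
      fun N ω => a N * L ω + b N * L' ω) atTop 0 := by
    refine tendstoInMeasure_of_tendsto_eLpNorm one_ne_zero
      (fun N => by simp only [Pi.sub_apply]; fun_prop) (by fun_prop) ?_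
    simp only [eLpNorm_one_eq_lintegral_enorm, sub_zero]
    have hz : Tendsto (fun N => ‖a N‖ₑ * ∫⁻ ω, ‖J N ω - L ω‖ₑ ∂P +
        ‖b N‖ₑ * ∫⁻ ω, ‖J' N ω - L' ω‖ₑ ∂P) atTop (𝓝 0) := by
      simpa using (ENNReal.Tendsto.mul ha.enorm (Or.inr ENNReal.zero_ne_top) h
        (Or.inr enorm_ne_top)).add
        (ENNReal.Tendsto.mul hb.enorm (Or.inr ENNReal.zero_ne_top) h' (Or.inr enorm_ne_top))
    refine tendsto_of_tendsto_of_tendsto_of_le_of_le tendsto_const_nhds hz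
      (fun _ => zero_le) fun N => ?_
    dsimp only
    rw [← lintegral_const_mul' _ _ enorm_ne_top, ← lintegral_const_mul' _ _ enorm_ne_top,
      ← lintegral_add_left (by fun_prop)]
    refine lintegral_mono fun ω => ?_
    simp only [Pi.sub_apply]
    rw [← enorm_mul, ← enorm_mul]
    refine le_trans (le_of_eq ?_) (enorm_add_le _ _)
    congr 1
    ring
  have := (tendstoInDistribution_of_tendstoInMeasure_sub _ _ hlim hdiff
    fun N => by fun_prop).tendsto
  refine (ProbabilityMeasure.tendsto_iff_forall_integral_tendsto.1 this f).congr fun N => ?_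
  rw [ProbabilityMeasure.coe_mk, integral_map (by fun_prop) (by fun_prop)]

lemma IsTwoSidedWiener.lintegral_enorm_bridgeSlope_sq {P : Measure Ω} {U : Ω → ℝ → ℝ}
    (hU : IsTwoSidedWiener P U) (b : Bool) :
    ∫⁻ ω, ‖bridgeSlope U ω b‖ₑ ^ (2 : ℝ) ∂P = ENNReal.ofReal 3 := by
  obtain ⟨h1, h2⟩ := hU.bridgeSlope_sq b
  rw [← h2, ofReal_integral_eq_lintegral_ofReal h1 (Eventually.of_forall fun ω => sq_nonneg _)]
  refine lintegral_congr fun ω => ?_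
  rw [← Real.enorm_of_nonneg (sq_nonneg _), enorm_pow, ← ENNReal.rpow_natCast]
  norm_num

lemma measurable_setIntegral_perturbed {p κ τ : ℝ} {W : Ω → ℝ → ℝ} {Y : Ω → ℝ}
    (hW : Measurable (Function.uncurry W)) (hY : Measurable Y) :
    Measurable fun ω => ∫ u in Ioc 1 (1 / (2 * τ)),
      |W ω u + √τ * u * Y ω| ^ p / (u * (1 - τ * u)) ^ κ := by
  have h := (measurable_perturbedIntegrand (p := p) (κ := κ) (τ := τ) hW
    hY).stronglyMeasurable.integral_prod_right (ν := volume)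
  convert h.measurable using 2 with ω
  exact (integral_indicator measurableSet_Ioc).symm

lemma measurable_setIntegral_weighted {p κ : ℝ} {W : Ω → ℝ → ℝ}
    (hW : Measurable (Function.uncurry W)) :
    Measurable fun ω => ∫ u in Ioi (1 : ℝ), |W ω u| ^ p / u ^ κ := by
  have h : Measurable (Function.uncurry fun ω u => |W ω u| ^ p / u ^ κ) := by
    have e : (Function.uncurry fun ω u => |W ω u| ^ p / u ^ κ) =
      fun z => |Function.uncurry W z| ^ p / z.2 ^ κ := rfl
    rw [e]; fun_prop
  exact (h.stronglyMeasurable.integral_prod_right (ν := volume.restrict (Ioi 1))).measurable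

/-- The weighted functional over `(s, t)` splits at `1/2` into its two Brownian rescalings. -/
lemma rpow_mul_setIntegral_weighted_eq {p κ r s t : ℝ} (hp : 0 ≤ p) (hr : 0 ≤ r) (hs : 0 < s)
    (hs' : s ≤ 1 / 2) (ht : 1 / 2 ≤ t) (ht' : t < 1) {X Z Z' : ℝ → ℝ}
    (hX : ContinuousOn X (Icc 0 1))
    (hZ : ∀ u, 0 < u → s * u ≤ 1 / 2 → X (s * u) = √s * Z u)
    (hZ' : ∀ u, 0 < u → (1 - t) * u ≤ 1 / 2 → X (1 - (1 - t) * u) = √(1 - t) * Z' u) :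
    r ^ (κ - p / 2 - 1) * ∫ x in Ioc s t, |X x| ^ p / (x * (1 - x)) ^ κ =
      (r / s) ^ (κ - p / 2 - 1) *
          (∫ u in Ioc 1 (1 / (2 * s)), |Z u| ^ p / (u * (1 - s * u)) ^ κ) +
        (r / (1 - t)) ^ (κ - p / 2 - 1) *
          ∫ u in Ioc 1 (1 / (2 * (1 - t))), |Z' u| ^ p / (u * (1 - (1 - t) * u)) ^ κ := by
  have ht0 : 0 < 1 - t := by linarith
  have hcont : ContinuousOn (fun x => |X x| ^ p / (x * (1 - x)) ^ κ) (Icc s t) :=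
    (continuousOn_weighted hp hs ht').comp (f := fun x => (x, X x))
      (continuousOn_id.prodMk (hX.mono (Icc_subset_Icc hs.le ht'.le)))
      fun x hx => ⟨hx, mem_univ _⟩
  have hint : IntegrableOn (fun x => |X x| ^ p / (x * (1 - x)) ^ κ) (Ioc s t) :=
    hcont.integrableOn_Icc.mono_set Ioc_subset_Icc_self
  rw [← Ioc_union_Ioc_eq_Ioc hs' ht, setIntegral_union (Ioc_disjoint_Ioc_of_le le_rfl)
    measurableSet_Ioc (hint.mono_set (Ioc_subset_Ioc_right ht))
    (hint.mono_set (Ioc_subset_Ioc_left hs')), setIntegral_weighted_scale hs hs' hZ,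
    setIntegral_weighted_reflect ht,
    setIntegral_weighted_scale (X := fun x => X (1 - x)) ht0 (by linarith) hZ',
    Real.rpow_neg hs.le, Real.rpow_neg ht0.le, Real.div_rpow hr hs.le, Real.div_rpow hr ht0.le]
  ring

lemma wienerBridge_mul_eq {Ω : Type*} {U V : Ω → ℝ → ℝ} {ω : Ω} {α u : ℝ} (hα : 0 < α)
    (hU : U ω (α * u) = √α * V ω u) (hu : α * u ≤ 1 / 2) :
    wienerBridge U ω (α * u) = √α * (V ω u + √α * u * bridgeSlope U ω true) := by
  rw [wienerBridge, if_pos hu, hU]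
  linear_combination -(u * bridgeSlope U ω true) * Real.mul_self_sqrt hα.le

lemma wienerBridge_one_sub_mul_eq {Ω : Type*} {U V : Ω → ℝ → ℝ} {ω : Ω} {β u : ℝ} (hβ : 0 < β)
    (hU : U ω (-(β * u)) = √β * V ω (-u)) (hu : β * u ≤ 1 / 2) :
    wienerBridge U ω (1 - β * u) = √β * (V ω (-u) + √β * u * bridgeSlope U ω false) := by
  rw [wienerBridge_of_half_le (by linarith), sub_sub_cancel_left, hU]
  linear_combination -(u * bridgeSlope U ω false) * Real.mul_self_sqrt hβ.le

/-- Lemma 3 of the paper: Rényi-type limit theorem for the heavily weighted `L^p`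
functional of a Brownian bridge over `(t_1(N), t_2(N))`. -/
theorem statement5 {Ω' : Type*} [MeasurableSpace Ω']
    (Q : Measure Ω) [IsProbabilityMeasure Q]
    (Q' : Measure Ω') [IsProbabilityMeasure Q']
    (p κ : ℝ) (hp : 1 ≤ p) (hκ : p/2 + 1 < κ)
    (B : Ω → ℝ → ℝ) (hB : IsBrownianBridge Q B)
    (t1 t2 : ℕ → ℝ) (hends : ∀ N, 0 < t1 N ∧ t1 N < t2 N ∧ t2 N < 1)
    (ht1 : Tendsto t1 atTop (𝓝 0)) (ht2 : Tendsto t2 atTop (𝓝 1))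
    (γ1 γ2 : ℝ)
    (hγ1 : Tendsto (fun N => min (t1 N) (1 - t2 N) / t1 N) atTop (𝓝 γ1))
    (hγ2 : Tendsto (fun N => min (t1 N) (1 - t2 N) / (1 - t2 N)) atTop (𝓝 γ2))
    -- two independent standard Wiener processes generating the limit variables
    (Wa Wb : Ω' → ℝ → ℝ)
    (hWa : IsWienerProcessOn Q' Wa (Ici 0)) (hWb : IsWienerProcessOn Q' Wb (Ici 0))
    (hindep : IndepFun Wa Wb Q') :
    TendstoInDist Q
      (fun N ω => (min (t1 N) (1 - t2 N)) ^ (κ - p/2 - 1) *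
        ∫ t in Ioc (t1 N) (t2 N), |B ω t| ^ p / (t * (1 - t)) ^ κ)
      (Q'.map (fun ω =>
        γ1 ^ (κ - p/2 - 1) * (∫ t in Ioi (1:ℝ), |Wa ω t| ^ p / t ^ κ)
          + γ2 ^ (κ - p/2 - 1) * (∫ t in Ioi (1:ℝ), |Wb ω t| ^ p / t ^ κ))) := by
  have hp0 : 0 ≤ p := by linarith
  have he : 0 < κ - p / 2 - 1 := by linarith
  obtain ⟨V, hV, hVW⟩ := exists_isTwoSidedWiener hWa hWb hindep
  have hα0 : ∀ N, 0 < t1 N := fun N => (hends N).1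
  have hβ0 : ∀ N, 0 < 1 - t2 N := fun N => by linarith [(hends N).2.2]
  have hβ : Tendsto (fun N => 1 - t2 N) atTop (𝓝 0) := by simpa using ht2.const_sub 1
  let U : ℕ → Ω' → ℝ → ℝ := fun N ω x =>
    if 0 ≤ x then √(t1 N) * V ω (x / t1 N) else √(1 - t2 N) * V ω (x / (1 - t2 N))
  have hU : ∀ N, IsTwoSidedWiener Q' (U N) := fun N => hV.rescale (hα0 N) (hβ0 N)
  have hX : ∀ N, IsBrownianBridge Q' (wienerBridge (U N)) := fun N =>
    (hU N).isBrownianBridge_wienerBridge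
  have hleft : ∀ N ω u, 0 < u → t1 N * u ≤ 1 / 2 → wienerBridge (U N) ω (t1 N * u) =
      √(t1 N) * (V ω u + √(t1 N) * u * bridgeSlope (U N) ω true) := by
    intro N ω u hu
    have := hα0 N
    refine wienerBridge_mul_eq this ?_
    simp only [U]
    rw [if_pos (by positivity), mul_div_cancel_left₀ _ this.ne']
  have hright : ∀ N ω u, 0 < u → (1 - t2 N) * u ≤ 1 / 2 →
      wienerBridge (U N) ω (1 - (1 - t2 N) * u) =
        √(1 - t2 N) * (V ω (-u) + √(1 - t2 N) * u * bridgeSlope (U N) ω false) := by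
    intro N ω u hu
    have := hβ0 N
    refine wienerBridge_one_sub_mul_eq this ?_
    simp only [U]
    rw [if_neg (not_le.2 (neg_lt_zero.2 (mul_pos this hu))), ← mul_neg,
      mul_div_cancel_left₀ _ this.ne']
  have hVa : Measurable (Function.uncurry V) := hV.measurable_uncurry
  have hVb : Measurable (Function.uncurry fun ω u => V ω (-u)) :=
    hVa.comp (measurable_fst.prodMk measurable_snd.neg)
  have hconvA := tendsto_lintegral_enorm_perturbed hp hκ hVa
    (fun u hu => by
      obtain ⟨v, hv, h⟩ := hV.map_eq u
      exact ⟨v, by rw [hv, abs_of_pos (by linarith)], h⟩)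
    hα0 ht1 (fun N => (hU N).measurable_bridgeSlope true) ENNReal.ofReal_ne_top
    (fun N => ((hU N).lintegral_enorm_bridgeSlope_sq true).le)
    (fun N u hu huN => by
      have := mul_pos (hα0 N) (one_pos.trans_le hu)
      exact (hX N).exists_map_of_eq_sqrt_mul (hα0 N) ⟨this.le, by linarith⟩ (by nlinarith)
        fun ω => hleft N ω u (by linarith) huN)
  have hconvB := tendsto_lintegral_enorm_perturbed hp hκ hVb
    (fun u hu => by
      obtain ⟨v, hv, h⟩ := hV.map_eq (-u)
      exact ⟨v, by rw [hv, abs_neg, abs_of_pos (by linarith)], h⟩)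
    hβ0 hβ (fun N => (hU N).measurable_bridgeSlope false) ENNReal.ofReal_ne_top
    (fun N => ((hU N).lintegral_enorm_bridgeSlope_sq false).le)
    (fun N u hu huN => by
      have := mul_pos (hβ0 N) (one_pos.trans_le hu)
      exact (hX N).exists_map_of_eq_sqrt_mul (hβ0 N) (t := 1 - (1 - t2 N) * u)
        ⟨by linarith, by linarith⟩ (by nlinarith) fun ω => hright N ω u (by linarith) huN)
  intro f
  have hlimit : Q'.map (fun ω =>
      γ1 ^ (κ - p/2 - 1) * (∫ t in Ioi (1:ℝ), |Wa ω t| ^ p / t ^ κ)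
        + γ2 ^ (κ - p/2 - 1) * (∫ t in Ioi (1:ℝ), |Wb ω t| ^ p / t ^ κ)) =
      Q'.map (fun ω =>
        γ1 ^ (κ - p/2 - 1) * (∫ t in Ioi (1:ℝ), |V ω t| ^ p / t ^ κ)
          + γ2 ^ (κ - p/2 - 1) * (∫ t in Ioi (1:ℝ), |V ω (-t)| ^ p / t ^ κ)) := by
    refine Measure.map_congr ?_
    filter_upwards [hVW] with ω hω
    congr 2 <;> refine setIntegral_congr_fun measurableSet_Ioi fun t ht => ?_
    · simp only [hω.1 t (zero_le_one.trans (mem_Ioi.1 ht).le)]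
    · simp only [hω.2 t (zero_le_one.trans (mem_Ioi.1 ht).le)]
  rw [hlimit]
  refine (tendsto_integral_comp_linearCombination
    (fun N => measurable_setIntegral_perturbed hVa ((hU N).measurable_bridgeSlope true))
    (fun N => measurable_setIntegral_perturbed hVb ((hU N).measurable_bridgeSlope false))
    (measurable_setIntegral_weighted hVa) (measurable_setIntegral_weighted hVb) hconvA hconvB
    (hγ1.rpow_const (Or.inr he.le)) (hγ2.rpow_const (Or.inr he.le)) f).congr' ?_
  filter_upwards [ht1.eventually_le_const (show (0 : ℝ) < 1 / 2 by norm_num),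
    ht2.eventually_const_le (show (1 / 2 : ℝ) < 1 by norm_num)] with N h1 h2
  rw [hB.gauss.integral_comp_setIntegral_eq (hX N).gauss hB.meas (hX N).meas
    (fun s hs t ht => by rw [hB.cov s hs t ht, (hX N).cov s hs t ht]) hB.cont (hX N).cont
    (hends N).2.1.le (Icc_subset_Icc (hα0 N).le (hends N).2.2.le)
    (φ := fun t x => |x| ^ p / (t * (1 - t)) ^ κ)
    (continuousOn_weighted hp0 (hα0 N) (hends N).2.2) f]
  refine integral_congr_ae ?_
  filter_upwards [(hX N).cont] with ω hω
  rw [rpow_mul_setIntegral_weighted_eq hp0 (le_min (hα0 N).le (hβ0 N).le) (hα0 N) h1 h2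
    (hends N).2.2 hω (hleft N ω) (hright N ω)]

end
end

section
/- Let {B(t), 0 ≤ t ≤ 1} be a Brownian bridge and let 0 ≤ ζ < 1/2. Then N^{1/2−ζ} sup_{0 < t ≤ 1/(N+1)} |B(t)| / t^ζ is bounded in probability as N → ∞ (i.e., sup_{0 < t ≤ 1/(N+1)} |B(t)|/t^ζ = O_P(N^{ζ−1/2})), and likewise N^{1/2−ζ} sup_{N/(N+1) ≤ t < 1} |B(t)| / (1−t)^ζ is bounded in probability. -/
open MeasureTheory ProbabilityTheory Filter Set Topology

noncomputable section

variable {Ω : Type*} [MeasurableSpace Ω]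

/-- Deterministic dyadic chaining bound. -/
theorem abs_le_of_dyadic_increments {f : ℝ → ℝ} {a S : ℝ} {d : ℕ → ℝ} (ha : 0 < a)
    (hf : ContinuousOn f (Icc 0 a)) (h0 : f 0 = 0)
    (hd : ∀ n k : ℕ, k < 2 ^ n →
      |f (a * (((k + 1 : ℕ) : ℝ) / 2 ^ n)) - f (a * ((k : ℝ) / 2 ^ n))| ≤ d n)
    (hS : ∀ n, ∑ i ∈ Finset.range n, d i ≤ S) {t : ℝ} (ht : t ∈ Icc 0 a) : |f t| ≤ S := by
  have hd0 : ∀ n, 0 ≤ d n := fun n => (abs_nonneg _).trans (hd n 0 (by positivity))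
  have grid : ∀ n k : ℕ, k ≤ 2 ^ n →
      |f (a * ((k : ℝ) / 2 ^ n))| ≤ ∑ i ∈ Finset.range (n + 1), d i := by
    intro n
    induction n with
    | zero =>
      intro k hk
      have h1 := hd 0 0 (by norm_num)
      have hk' : k = 0 ∨ k = 1 := by
        rw [pow_zero] at hk
        lia
      rcases hk' with rfl | rfl
      · simpa [h0] using hd0 0
      · simpa [h0] using h1
    | succ n ih =>
      intro k hk
      rw [Finset.sum_range_succ]
      have half : ∀ j : ℕ, ((2 * j : ℕ) : ℝ) / 2 ^ (n + 1) = (j : ℝ) / 2 ^ n := by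
        intro j
        push_cast
        field_simp
        ring
      rcases Nat.even_or_odd' k with ⟨j, rfl | rfl⟩
      · rw [half]
        have := ih j (by rw [pow_succ] at hk; lia)
        linarith [hd0 (n + 1)]
      · have h1 := hd (n + 1) (2 * j) (by lia)
        have h2 := ih j (by rw [pow_succ] at hk; lia)
        rw [half] at h1
        have h3 := abs_sub_abs_le_abs_sub (f (a * (((2 * j + 1 : ℕ) : ℝ) / 2 ^ (n + 1))))
          (f (a * ((j : ℝ) / 2 ^ n)))
        linarith
  have hta : 0 ≤ t / a := div_nonneg ht.1 ha.le
  have hlim : Tendsto (fun n : ℕ => a * ((⌊t / a * 2 ^ n⌋₊ : ℝ) / 2 ^ n)) atTop (𝓝 t) := by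
    have h1 : Tendsto (fun n : ℕ => (2 : ℝ) ^ n) atTop atTop :=
      tendsto_pow_atTop_atTop_of_one_lt one_lt_two
    have h2 := ((tendsto_nat_floor_mul_div_atTop hta).comp h1).const_mul a
    rwa [mul_div_cancel₀ _ ha.ne'] at h2
  have hfloor : ∀ n : ℕ, ⌊t / a * 2 ^ n⌋₊ ≤ 2 ^ n := by
    intro n
    apply Nat.floor_le_of_le
    push_cast
    exact mul_le_of_le_one_left (by positivity) ((div_le_one ha).2 ht.2)
  have hmem : ∀ n : ℕ, a * ((⌊t / a * 2 ^ n⌋₊ : ℝ) / 2 ^ n) ∈ Icc 0 a := by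
    intro n
    refine ⟨by positivity, mul_le_of_le_one_right ha.le ?_⟩
    rw [div_le_one (by positivity)]
    exact_mod_cast hfloor n
  have hflim := (hf t ht).tendsto.comp
    (tendsto_nhdsWithin_iff.2 ⟨hlim, Eventually.of_forall hmem⟩)
  exact le_of_tendsto hflim.abs
    (Eventually.of_forall fun n => (grid n _ (hfloor n)).trans (hS _))

/-- The fourth-moment type tail bound `P(|X_s - X_t| ≥ c) ≤ K (s - t)² / c⁴` on `[0,1]`. -/
def HasQuarticTails (P : Measure Ω) (X : Ω → ℝ → ℝ) (K : ℝ) : Prop :=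
  ∀ s ∈ Icc (0 : ℝ) 1, ∀ t ∈ Icc (0 : ℝ) 1, ∀ c : ℝ, 0 < c →
    P {ω | c ≤ |X ω s - X ω t|} ≤ ENNReal.ofReal (K * (s - t) ^ 2 / c ^ 4)

/-- A countable union bound with geometrically decaying probabilities. -/
theorem measure_iUnion_le_geometric {P : Measure Ω} {A : ℕ → Set Ω} {C q : ℝ} (hC : 0 ≤ C)
    (hq : 0 ≤ q) (hq1 : q < 1) (hA : ∀ n, P (A n) ≤ ENNReal.ofReal (C * q ^ n)) :
    P (⋃ n, A n) ≤ ENNReal.ofReal (C * (1 - q)⁻¹) := by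
  calc P (⋃ n, A n) ≤ ∑' n, P (A n) := measure_iUnion_le _
    _ ≤ ∑' n, ENNReal.ofReal (C * q ^ n) := ENNReal.tsum_le_tsum hA
    _ = ENNReal.ofReal (∑' n, C * q ^ n) :=
      (ENNReal.ofReal_tsum_of_nonneg (fun n => by positivity)
        ((summable_geometric_of_lt_one hq hq1).mul_left C)).symm
    _ = ENNReal.ofReal (C * (1 - q)⁻¹) := by
      rw [tsum_mul_left, tsum_geometric_of_lt_one hq hq1]

/-- Maximal inequality at scale `a` for a process with quartic tails of increments. -/
theorem HasQuarticTails.exists_measure_exceed_le {P : Measure Ω} {X : Ω → ℝ → ℝ} {K : ℝ}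
    (hK : 0 ≤ K) (hX : HasQuarticTails P X K)
    (hcont : ∀ᵐ ω ∂P, ContinuousOn (X ω) (Icc 0 1)) (hzero : ∀ᵐ ω ∂P, X ω 0 = 0) :
    ∃ C : ℝ, 0 ≤ C ∧ ∀ a : ℝ, 0 < a → a ≤ 1 → ∀ c : ℝ, 0 < c →
      P {ω | ¬ ∀ t ∈ Icc 0 a, |X ω t| ≤ c * √a} ≤ ENNReal.ofReal (C / c ^ 4) := by
  refine ⟨K * 10 ^ 4 * (1 - 5000 / 6561)⁻¹, by positivity, fun a ha ha1 c hc => ?_⟩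
  set d : ℕ → ℝ := fun n => c * √a * (1 / 10) * (9 / 10) ^ n with hd
  have hdpos : ∀ n, 0 < d n := fun n => by positivity
  set A : ℕ → Set Ω := fun n => ⋃ k ∈ Finset.range (2 ^ n),
    {ω | d n ≤ |X ω (a * (((k + 1 : ℕ) : ℝ) / 2 ^ n)) - X ω (a * ((k : ℝ) / 2 ^ n))|} with hA
  have hgrid : ∀ n k : ℕ, k ≤ 2 ^ n → a * ((k : ℝ) / 2 ^ n) ∈ Icc (0 : ℝ) 1 := by
    intro n k hk
    have : (k : ℝ) / 2 ^ n ≤ 1 := by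
      rw [div_le_one (by positivity)]
      exact_mod_cast hk
    exact ⟨by positivity, mul_le_one₀ ha1 (by positivity) this⟩
  have hPA : ∀ n, P (A n) ≤ ENNReal.ofReal (K * 10 ^ 4 / c ^ 4 * (5000 / 6561) ^ n) := by
    intro n
    have hterm : ∀ k ∈ Finset.range (2 ^ n),
        P {ω | d n ≤ |X ω (a * (((k + 1 : ℕ) : ℝ) / 2 ^ n)) - X ω (a * ((k : ℝ) / 2 ^ n))|} ≤
          ENNReal.ofReal (K * (a / 2 ^ n) ^ 2 / d n ^ 4) := by
      intro k hk
      rw [Finset.mem_range] at hk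
      refine (hX _ (hgrid n _ hk) _ (hgrid n k hk.le) _ (hdpos n)).trans_eq ?_
      congr 4
      push_cast
      ring
    refine (measure_biUnion_finset_le _ _).trans ((Finset.sum_le_sum hterm).trans_eq ?_)
    rw [Finset.sum_const, Finset.card_range, nsmul_eq_mul,
      ← ENNReal.ofReal_natCast, ← ENNReal.ofReal_mul (by positivity)]
    congr 1
    have hsq : √a ^ 4 = a ^ 2 := by
      rw [show 4 = 2 * 2 from rfl, pow_mul, Real.sq_sqrt ha.le]
    have hpow : (5000 / 6561 : ℝ) ^ n * (2 ^ n * ((9 / 10) ^ n) ^ 4) = 1 := by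
      rw [← pow_mul, mul_comm n 4, pow_mul, ← mul_pow, ← mul_pow]
      norm_num
    have hd4 : d n ^ 4 = c ^ 4 * a ^ 2 * (1 / 10) ^ 4 * ((9 / 10) ^ n) ^ 4 := by
      rw [hd]
      simp only [mul_pow]
      rw [hsq]
    rw [hd4]
    push_cast
    have h9 : (0 : ℝ) < (9 / 10) ^ n := by positivity
    generalize ((9 / 10 : ℝ) ^ n) = y at *
    generalize ((5000 / 6561 : ℝ) ^ n) = z at *
    have h2 : (0 : ℝ) < 2 ^ n := by positivity
    generalize ((2 : ℝ) ^ n) = x at *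
    have hz : z = (x * y ^ 4)⁻¹ := eq_inv_of_mul_eq_one_left hpow
    rw [hz]
    field_simp
  have hnull : P {ω | ¬ (ContinuousOn (X ω) (Icc 0 1) ∧ X ω 0 = 0)} = 0 :=
    ae_iff.1 (hcont.and hzero)
  have hsub : {ω | ¬ ∀ t ∈ Icc 0 a, |X ω t| ≤ c * √a} ⊆
      {ω | ¬ (ContinuousOn (X ω) (Icc 0 1) ∧ X ω 0 = 0)} ∪ ⋃ n, A n := by
    intro ω hω
    by_contra hnot
    rw [mem_union, not_or] at hnot
    obtain ⟨h1, h2⟩ := hnot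
    simp only [mem_ofPred_eq, not_not] at h1
    refine hω fun t ht => abs_le_of_dyadic_increments ha
      (h1.1.mono (Icc_subset_Icc_right ha1)) h1.2 (d := d) (fun n k hk => ?_) (fun n => ?_) ht
    · by_contra! hlt
      exact h2 (mem_iUnion.2 ⟨n, mem_biUnion (Finset.mem_coe.2 (Finset.mem_range.2 hk)) hlt.le⟩)
    · rw [hd, ← Finset.mul_sum]
      have hgeom := (summable_geometric_of_lt_one (r := (9 / 10 : ℝ)) (by norm_num)
        (by norm_num)).sum_le_tsum (Finset.range n) (fun i _ => by positivity)
      rw [tsum_geometric_of_lt_one (by norm_num) (by norm_num)] at hgeom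
      have hca : 0 ≤ c * √a := by positivity
      nlinarith
  calc P {ω | ¬ ∀ t ∈ Icc 0 a, |X ω t| ≤ c * √a}
      ≤ P {ω | ¬ (ContinuousOn (X ω) (Icc 0 1) ∧ X ω 0 = 0)} + P (⋃ n, A n) :=
        (measure_mono hsub).trans (measure_union_le _ _)
    _ ≤ ENNReal.ofReal (K * 10 ^ 4 / c ^ 4 * (1 - 5000 / 6561)⁻¹) := by
        rw [hnull, zero_add]
        exact measure_iUnion_le_geometric (by positivity) (by norm_num) (by norm_num) hPA
    _ = _ := by
        congr 1
        ring

/-- Weighted maximal inequality near `0`, by summing the unweighted one over dyadic blocks. -/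
theorem exists_measure_weighted_exceed_le {P : Measure Ω} {X : Ω → ℝ → ℝ} {C ζ : ℝ}
    (hC : 0 ≤ C) (hζ0 : 0 ≤ ζ) (hζ : ζ < 1 / 2)
    (hX : ∀ a : ℝ, 0 < a → a ≤ 1 → ∀ c : ℝ, 0 < c →
      P {ω | ¬ ∀ t ∈ Icc 0 a, |X ω t| ≤ c * √a} ≤ ENNReal.ofReal (C / c ^ 4)) :
    ∃ C' : ℝ, 0 ≤ C' ∧ ∀ δ : ℝ, 0 < δ → δ ≤ 1 → ∀ M : ℝ, 0 < M →
      P {ω | ¬ ∀ t ∈ Ioc 0 δ, |X ω t| ≤ M * δ ^ (1 / 2 - ζ) * t ^ ζ} ≤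
        ENNReal.ofReal (C' / M ^ 4) := by
  set b : ℝ := 2 ^ (1 / 2 - ζ) with hb
  have hb1 : 1 < b := Real.one_lt_rpow one_lt_two (by linarith)
  have hb0 : 0 < b := by positivity
  set q : ℝ := (b ^ 4)⁻¹ with hq
  have hq1 : q < 1 := inv_lt_one_of_one_lt₀ (one_lt_pow₀ hb1 (by norm_num))
  have hq0 : 0 ≤ q := by positivity
  set h : ℝ := (1 / 2) ^ ζ with hh
  have hh0 : 0 < h := by positivity
  refine ⟨C / h ^ 4 * (1 - q)⁻¹,
    mul_nonneg (by positivity) (inv_nonneg.2 (by linarith)), fun δ hδ hδ1 M hM => ?_⟩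
  set A : ℕ → Set Ω := fun j =>
    {ω | ¬ ∀ t ∈ Icc 0 (δ * (1 / 2) ^ j), |X ω t| ≤ M * h * b ^ j * √(δ * (1 / 2) ^ j)} with hA
  have hPA : ∀ j, P (A j) ≤ ENNReal.ofReal (C / h ^ 4 / M ^ 4 * q ^ j) := by
    intro j
    refine (hX _ (by positivity)
      (mul_le_one₀ hδ1 (by positivity) (pow_le_one₀ (by norm_num) (by norm_num))) _
      (by positivity)).trans_eq ?_
    congr 1
    rw [hq, inv_pow, ← pow_mul, mul_comm 4 j, pow_mul]
    field_simp
  have hsub : {ω | ¬ ∀ t ∈ Ioc 0 δ, |X ω t| ≤ M * δ ^ (1 / 2 - ζ) * t ^ ζ} ⊆ ⋃ j, A j := by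
    intro ω hω
    by_contra hnot
    refine hω fun t ht => ?_
    obtain ⟨j, hj1, hj2⟩ := exists_nat_pow_near_of_lt_one (x := t / δ) (y := (1 / 2 : ℝ))
      (div_pos ht.1 hδ) ((div_le_one hδ).2 ht.2) (by norm_num) (by norm_num)
    rw [lt_div_iff₀ hδ] at hj1
    rw [div_le_iff₀ hδ] at hj2
    have hgood : ∀ t ∈ Icc 0 (δ * (1 / 2) ^ j), |X ω t| ≤ M * h * b ^ j * √(δ * (1 / 2) ^ j) := by
      by_contra hbad
      exact hnot (mem_iUnion.2 ⟨j, hbad⟩)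
    refine (hgood t ⟨ht.1.le, by linarith⟩).trans ?_
    have hkey : h * b ^ j * √(δ * (1 / 2) ^ j) =
        δ ^ (1 / 2 - ζ) * ((1 / 2) ^ (j + 1) * δ) ^ ζ := by
      have hbinv : b = (1 / 2 : ℝ) ^ (ζ - 1 / 2) := by
        rw [hb, one_div, Real.inv_rpow zero_le_two, ← Real.rpow_neg zero_le_two]
        congr 1
        ring
      rw [hbinv, hh, Real.sqrt_eq_rpow, Real.mul_rpow hδ.le (by positivity),
        Real.mul_rpow (by positivity) hδ.le, ← Real.rpow_natCast, ← Real.rpow_natCast,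
        ← Real.rpow_natCast, ← Real.rpow_mul (by norm_num), ← Real.rpow_mul (by norm_num),
        ← Real.rpow_mul (by norm_num)]
      have e1 : δ ^ (1 / 2 - ζ) * δ ^ ζ = δ ^ (1 / 2 : ℝ) := by
        rw [← Real.rpow_add hδ]
        congr 1
        ring
      have e2 : (1 / 2 : ℝ) ^ ζ * (1 / 2 : ℝ) ^ ((ζ - 1 / 2) * j) *
          (1 / 2 : ℝ) ^ ((j : ℝ) * (1 / 2)) = (1 / 2 : ℝ) ^ (((j + 1 : ℕ) : ℝ) * ζ) := by
        rw [← Real.rpow_add (by norm_num), ← Real.rpow_add (by norm_num)]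
        congr 1
        push_cast
        ring
      rw [← e2, ← e1]
      ring
    calc M * h * b ^ j * √(δ * (1 / 2) ^ j)
        = M * δ ^ (1 / 2 - ζ) * ((1 / 2) ^ (j + 1) * δ) ^ ζ := by
          rw [mul_assoc M, mul_assoc M, hkey]
          ring
      _ ≤ M * δ ^ (1 / 2 - ζ) * t ^ ζ := by gcongr
  calc _ ≤ P (⋃ j, A j) := measure_mono hsub
    _ ≤ ENNReal.ofReal (C / h ^ 4 / M ^ 4 * (1 - q)⁻¹) :=
        measure_iUnion_le_geometric (by positivity) hq0 hq1 hPA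
    _ = _ := by
        congr 1
        ring

/-- Tail bound for a centred Gaussian variable of variance at most `w`. -/
theorem measure_le_abs_le_of_map_eq_gaussianReal {P : Measure Ω} [IsProbabilityMeasure P]
    {Y : Ω → ℝ} (hY : Measurable Y) {v : NNReal} (hlaw : P.map Y = gaussianReal 0 v) {w c : ℝ}
    (hw : 0 < w) (hvw : (v : ℝ) ≤ w) (hc : 0 < c) :
    P {ω | c ≤ |Y ω|} ≤ ENNReal.ofReal (16 * w ^ 2 / c ^ 4) := by
  have one_sided : ∀ Z : Ω → ℝ, Measurable Z → P.map Z = gaussianReal 0 v →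
      P {ω | c ≤ Z ω} ≤ ENNReal.ofReal (8 * w ^ 2 / c ^ 4) := by
    intro Z hZ hZlaw
    have hint : Integrable (fun ω => Real.exp (c / w * Z ω)) P := by
      have h1 : Integrable (fun x => Real.exp (c / w * x)) (P.map Z) := by
        rw [hZlaw]
        exact integrable_exp_mul_gaussianReal _
      exact h1.comp_measurable hZ
    have h1 := measure_ge_le_exp_mul_mgf c (div_pos hc hw).le hint
    rw [mgf_gaussianReal hZlaw, ← Real.exp_add] at h1
    have h2 : -(c / w) * c + (0 * (c / w) + v * (c / w) ^ 2 / 2) ≤ -(c ^ 2 / (2 * w)) := by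
      have h3 : (v : ℝ) * (c / w) ^ 2 ≤ w * (c / w) ^ 2 := by gcongr
      have h4 : w * (c / w) ^ 2 = c ^ 2 / w := by field_simp
      have h5 : c / w * c = c ^ 2 / w := by ring
      have h6 : c ^ 2 / (2 * w) = c ^ 2 / w / 2 := by field_simp
      rw [h6]
      linarith
    have h7 : Real.exp (-(c ^ 2 / (2 * w))) ≤ 8 * w ^ 2 / c ^ 4 := by
      have hx : 0 < c ^ 2 / (2 * w) := by positivity
      have h8 := Real.quadratic_le_exp_of_nonneg hx.le
      have h9 : (c ^ 2 / (2 * w)) ^ 2 / 2 ≤ Real.exp (c ^ 2 / (2 * w)) := by linarith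
      rw [Real.exp_neg]
      calc (Real.exp (c ^ 2 / (2 * w)))⁻¹ ≤ ((c ^ 2 / (2 * w)) ^ 2 / 2)⁻¹ := by gcongr
        _ = 8 * w ^ 2 / c ^ 4 := by
          field_simp
          norm_num
    rw [← ofReal_measureReal]
    exact ENNReal.ofReal_le_ofReal (h1.trans ((Real.exp_le_exp.2 h2).trans h7))
  have hneg : P.map (fun ω => -Y ω) = gaussianReal 0 v := by
    have := gaussianReal_map_neg (μ := 0) (v := v)
    rw [← hlaw, Measure.map_map measurable_neg hY, neg_zero, ← hlaw] at this
    rw [← hlaw]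
    exact this
  have hset : {ω | c ≤ |Y ω|} = {ω | c ≤ Y ω} ∪ {ω | c ≤ -Y ω} := by
    ext ω
    simp [le_abs]
  rw [hset]
  refine (measure_union_le _ _).trans
    ((add_le_add (one_sided Y hY hlaw) (one_sided _ hY.neg hneg)).trans_eq ?_)
  rw [← ENNReal.ofReal_add (by positivity) (by positivity)]
  congr 1
  ring

namespace IsBrownianBridge

variable {P : Measure Ω} {B : Ω → ℝ → ℝ}

theorem memLp_two (hB : IsBrownianBridge P B) {t : ℝ} (ht : t ∈ Icc (0 : ℝ) 1) :
    MemLp (fun ω => B ω t) 2 P := by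
  obtain ⟨v, hv⟩ := hB.gauss 1 (fun _ => t) (fun _ => ht) (fun _ => 1)
  simp only [Fin.sum_univ_one, one_mul] at hv
  have h : MemLp id 2 (P.map fun ω => B ω t) := by
    rw [hv]
    exact memLp_id_gaussianReal' 2 (by norm_num)
  exact h.comp_of_map (hB.meas t ht).aemeasurable

theorem integral_increment_sq (hB : IsBrownianBridge P B) {s t : ℝ} (hs : s ∈ Icc (0 : ℝ) 1)
    (ht : t ∈ Icc (0 : ℝ) 1) :
    ∫ ω, (B ω s - B ω t) ^ 2 ∂P = |s - t| - (s - t) ^ 2 := by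
  have hss : Integrable (fun ω => B ω s * B ω s) P :=
    (hB.memLp_two hs).integrable_mul (hB.memLp_two hs)
  have hst : Integrable (fun ω => B ω s * B ω t) P :=
    (hB.memLp_two hs).integrable_mul (hB.memLp_two ht)
  have htt : Integrable (fun ω => B ω t * B ω t) P :=
    (hB.memLp_two ht).integrable_mul (hB.memLp_two ht)
  have hexp : ∀ ω, (B ω s - B ω t) ^ 2 =
      B ω s * B ω s - 2 * (B ω s * B ω t) + B ω t * B ω t := fun ω => by ring
  simp only [hexp]
  rw [integral_add (by exact hss.sub (hst.const_mul 2)) htt, integral_sub hss (hst.const_mul 2),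
    integral_const_mul, hB.cov s hs s hs, hB.cov s hs t ht, hB.cov t ht t ht, min_self, min_self]
  rcases le_total s t with h | h
  · rw [min_eq_left h, abs_of_nonpos (by linarith)]
    ring
  · rw [min_eq_right h, abs_of_nonneg (by linarith)]
    ring

theorem ae_eq_zero_of_var_eq_zero (hB : IsBrownianBridge P B) {t : ℝ} (ht : t ∈ Icc (0 : ℝ) 1)
    (hvar : t - t * t = 0) : ∀ᵐ ω ∂P, B ω t = 0 := by
  have h := hB.cov t ht t ht
  rw [min_self, hvar, integral_eq_zero_iff_of_nonneg (fun ω => mul_self_nonneg _)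
    ((hB.memLp_two ht).integrable_mul (hB.memLp_two ht))] at h
  filter_upwards [h] with ω hω
  exact mul_self_eq_zero.1 hω

theorem hasQuarticTails [IsProbabilityMeasure P] (hB : IsBrownianBridge P B) :
    HasQuarticTails P B 16 := by
  intro s hs t ht c hc
  rcases eq_or_ne s t with rfl | hne
  · simp [hc.not_ge]
  obtain ⟨v, hv⟩ := hB.gauss 2 ![s, t] (by intro i; fin_cases i <;> assumption) ![1, -1]
  have hlaw : P.map (fun ω => B ω s - B ω t) = gaussianReal 0 v := by
    rw [← hv]
    congr 1
    ext ω
    simp [Fin.sum_univ_two, sub_eq_add_neg]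
  have hmeas : Measurable fun ω => B ω s - B ω t := (hB.meas s hs).sub (hB.meas t ht)
  have hvar : (v : ℝ) = |s - t| - (s - t) ^ 2 := by
    rw [← hB.integral_increment_sq hs ht, ← variance_id_gaussianReal (μ := 0) (v := v),
      variance_eq_integral measurable_id.aemeasurable]
    simp only [id_eq, integral_id_gaussianReal, sub_zero]
    rw [← hlaw, integral_map hmeas.aemeasurable (by fun_prop)]
  have h := measure_le_abs_le_of_map_eq_gaussianReal hmeas hlaw (w := |s - t|)
    (abs_pos.2 (sub_ne_zero.2 hne)) (by rw [hvar]; linarith [sq_nonneg (s - t)]) hc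
  rwa [sq_abs] at h

end IsBrownianBridge

/-- A normalized family controlled by the weighted maximal inequality is bounded in probability. -/
theorem isOP_of_weighted_exceed {P : Measure Ω} {X : Ω → ℝ → ℝ} {C ζ : ℝ} (hζ : ζ < 1 / 2)
    (hX : ∀ δ : ℝ, 0 < δ → δ ≤ 1 → ∀ M : ℝ, 0 < M →
      P {ω | ¬ ∀ t ∈ Ioc 0 δ, |X ω t| ≤ M * δ ^ (1 / 2 - ζ) * t ^ ζ} ≤ ENNReal.ofReal (C / M ^ 4))
    (ξ : ℕ → Ω → ℝ) (hξ0 : ∀ N ω, 0 ≤ ξ N ω)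
    (hξ : ∀ (N : ℕ) (ω : Ω) (R : ℝ), 0 ≤ R →
      (∀ t ∈ Ioc (0 : ℝ) (1 / ((N : ℝ) + 1)), |X ω t| ≤ R * t ^ ζ) → ξ N ω ≤ R) :
    IsOP P ξ (fun N => (N : ℝ) ^ (ζ - 1 / 2)) := by
  intro ε hε
  obtain ⟨M, hMε, hM⟩ : ∃ M : ℝ, C / M ^ 4 ≤ ε ∧ 0 < M := by
    have hlim : Tendsto (fun M : ℝ => C / M ^ 4) atTop (𝓝 0) :=
      tendsto_const_nhds.div_atTop (tendsto_pow_atTop (by norm_num))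
    exact ((hlim.eventually_le_const hε).and (eventually_gt_atTop 0)).exists
  refine ⟨M, fun N => ?_⟩
  have hδ0 : 0 < 1 / ((N : ℝ) + 1) := by positivity
  have hδ1 : 1 / ((N : ℝ) + 1) ≤ 1 := by
    rw [div_le_one (by positivity)]
    linarith [N.cast_nonneg (α := ℝ)]
  refine (measure_mono ?_).trans ((hX _ hδ0 hδ1 M hM).trans (ENNReal.ofReal_le_ofReal hMε))
  intro ω hω hgood
  have hR : 0 ≤ M * (1 / ((N : ℝ) + 1)) ^ (1 / 2 - ζ) := by positivity
  have hbound := hξ N ω _ hR hgood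
  rw [mem_ofPred_eq] at hω
  refine absurd hω (not_lt.2 ?_)
  beta_reduce
  rw [abs_of_nonneg (div_nonneg (hξ0 N ω) (by positivity))]
  rcases Nat.eq_zero_or_pos N with rfl | hN
  · rw [Nat.cast_zero, Real.zero_rpow (by linarith), div_zero]
    exact hM.le
  have hN' : (0 : ℝ) < N := by exact_mod_cast hN
  rw [div_le_iff₀ (by positivity)]
  refine hbound.trans (mul_le_mul_of_nonneg_left ?_ hM.le)
  rw [← neg_sub (1 / 2) ζ, Real.rpow_neg_eq_inv_rpow, ← one_div (N : ℝ)]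
  refine Real.rpow_le_rpow hδ0.le ?_ (by linarith)
  exact one_div_le_one_div_of_le hN' (by linarith)

/-- For a Brownian bridge and `0 ≤ ζ < 1/2`,
`sup_{0<t≤1/(N+1)} |B(t)|/t^ζ = O_P(N^{ζ−1/2})` and
`sup_{N/(N+1)≤t<1} |B(t)|/(1−t)^ζ = O_P(N^{ζ−1/2})`. -/
theorem statement11
    (Q : Measure Ω) [IsProbabilityMeasure Q]
    (B : Ω → ℝ → ℝ) (hB : IsBrownianBridge Q B)
    (ζ : ℝ) (hζ0 : 0 ≤ ζ) (hζ : ζ < 1/2) :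
    IsOP Q
      (fun N ω => ⨆ t : Ioc (0:ℝ) (1 / ((N:ℝ) + 1)), |B ω t| / (t:ℝ) ^ ζ)
      (fun N => (N:ℝ) ^ (ζ - 1/2)) ∧
    IsOP Q
      (fun N ω => ⨆ t : Ico ((N:ℝ) / ((N:ℝ) + 1)) 1, |B ω t| / (1 - (t:ℝ)) ^ ζ)
      (fun N => (N:ℝ) ^ (ζ - 1/2)) := by
  have hcomp : ∀ X : Ω → ℝ → ℝ, HasQuarticTails Q X 16 →
      (∀ᵐ ω ∂Q, ContinuousOn (X ω) (Icc 0 1)) → (∀ᵐ ω ∂Q, X ω 0 = 0) →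
      ∃ C : ℝ, ∀ δ : ℝ, 0 < δ → δ ≤ 1 → ∀ M : ℝ, 0 < M →
        Q {ω | ¬ ∀ t ∈ Ioc 0 δ, |X ω t| ≤ M * δ ^ (1 / 2 - ζ) * t ^ ζ} ≤
          ENNReal.ofReal (C / M ^ 4) := by
    intro X hX hcont hzero
    obtain ⟨C, hC, h⟩ := hX.exists_measure_exceed_le (by norm_num) hcont hzero
    obtain ⟨C', -, h'⟩ := exists_measure_weighted_exceed_le hC hζ0 hζ h
    exact ⟨C', h'⟩
  have hflip : ∀ t ∈ Icc (0 : ℝ) 1, 1 - t ∈ Icc (0 : ℝ) 1 :=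
    fun t ht => ⟨by linarith [ht.2], by linarith [ht.1]⟩
  constructor
  · obtain ⟨C, hC⟩ := hcomp B hB.hasQuarticTails hB.cont
      (hB.ae_eq_zero_of_var_eq_zero (by simp) (by simp))
    refine isOP_of_weighted_exceed hζ hC _ (fun N ω => ?_) (fun N ω R hR h => ?_)
    · exact Real.iSup_nonneg fun t => div_nonneg (abs_nonneg _) (Real.rpow_nonneg t.2.1.le _)
    · refine Real.iSup_le (fun t => ?_) hR
      rw [div_le_iff₀ (Real.rpow_pos_of_pos t.2.1 _)]
      exact h t t.2
  · obtain ⟨C, hC⟩ := hcomp (fun ω t => B ω (1 - t))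
      (fun s hs t ht c hc => by
        refine (hB.hasQuarticTails _ (hflip s hs) _ (hflip t ht) c hc).trans_eq ?_
        congr 3
        ring)
      (by
        filter_upwards [hB.cont] with ω hω
        exact hω.comp (by fun_prop) hflip)
      (by simpa using hB.ae_eq_zero_of_var_eq_zero (t := 1) (by simp) (by simp))
    refine isOP_of_weighted_exceed hζ hC _ (fun N ω => ?_) (fun N ω R hR h => ?_)
    · exact Real.iSup_nonneg fun t =>
        div_nonneg (abs_nonneg _) (Real.rpow_nonneg (sub_nonneg.2 t.2.2.le) _)
    · refine Real.iSup_le (fun t => ?_) hR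
      rw [div_le_iff₀ (Real.rpow_pos_of_pos (sub_pos.2 t.2.2) _)]
      have hsplit : (N : ℝ) / (N + 1) = 1 - 1 / (N + 1) := by
        field_simp
        ring
      have hmem : 1 - (t : ℝ) ∈ Ioc (0 : ℝ) (1 / ((N : ℝ) + 1)) :=
        ⟨sub_pos.2 t.2.2, by linarith [hsplit.symm.trans_le t.2.1]⟩
      simpa using h _ hmem

end
end
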